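/- arXiv:1303.2996 — 6 statements merged into one kernel-verified Lean document; each statement's English description precedes it below -/
import Mathlib

section
/- Let F : ℂ → ℂ be a measurable function in the class 𝔇_{1,-}, i.e., for every a > 0 there is a constant C_a such that |F(z)| ≤ C_a e^{|z|² − a|z|} for all z ∈ ℂ. Suppose there exist N ∈ ℕ and entire functions f_1,…,f_N, g_1,…,g_N : ℂ → ℂ, each also belonging to 𝔇_{1,-}, such that for all z, z' ∈ ℂ: (1/π) ∫_ℂ F(w) e^{w·conj(z) + conj(w)·z'} e^{−|w|²} dλ(w) = Σ_{j=1}^N conj(g_j(z)) · f_j(z'). Then F = 0 almost everywhere on ℂ. -/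
open MeasureTheory Complex Filter

/-- A function belongs to the class `𝔇_{1,-}` if for every `a > 0` there is a
constant `C` with `|h z| ≤ C e^{|z|² - a|z|}` for all `z`. -/
def MemDOneMinus (h : ℂ → ℂ) : Prop :=
  ∀ a : ℝ, 0 < a → ∃ C : ℝ, ∀ z : ℂ, ‖h z‖ ≤ C * Real.exp (‖z‖ ^ 2 - a * ‖z‖)

open scoped Topology FourierTransform ComplexConjugate ContDiff

/-- An integrable function whose Fourier transform vanishes is zero almost everywhere. -/
theorem ae_eq_zero_of_fourier_eq_zero {V : Type*} [NormedAddCommGroup V] [InnerProductSpace ℝ V]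
    [MeasurableSpace V] [BorelSpace V] [FiniteDimensional ℝ V] {h : V → ℂ}
    (hint : Integrable h) (hzero : ∀ ξ, 𝓕 h ξ = 0) : h =ᵐ[volume] 0 := by
  refine ae_eq_zero_of_integral_contDiff_smul_eq_zero hint.locallyIntegrable fun φ hφ hcpt => ?_
  have hcpt' : HasCompactSupport (Complex.ofRealCLM ∘ φ) := hcpt.comp_left rfl
  have hφ' : ContDiff ℝ ∞ (Complex.ofRealCLM ∘ φ) := by fun_prop
  set ψ : SchwartzMap V ℂ := 𝓕⁻ (hcpt'.toSchwartzMap hφ') with hψ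
  have hFψ : 𝓕 (ψ : V → ℂ) = fun x => (φ x : ℂ) := by
    rw [← SchwartzMap.fourier_coe, hψ, FourierTransform.fourier_fourierInv_eq]
    rfl
  have key := VectorFourier.integral_fourierIntegral_smul_eq_flip (L := innerₗ V)
    (μ := volume) (ν := volume)
    Real.continuous_fourierChar continuous_inner ψ.integrable hint
  rw [flip_innerₗ] at key
  change ∫ ξ, 𝓕 (ψ : V → ℂ) ξ • h ξ = ∫ x, ψ x • 𝓕 h x at key
  simpa [hFψ, hzero] using key

/-- Linearly independent functions are separated by suitable evaluation points. -/
theorem exists_det_ne_zero_of_linearIndependent {X : Type*} {n : ℕ} {a : Fin n → X → ℂ}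
    (ha : LinearIndependent ℂ a) :
    ∃ s : Fin n → X, (Matrix.of fun i j => a j (s i)).det ≠ 0 := by
  have hspan : Submodule.span ℂ (Set.range fun x j => a j x) = ⊤ := by
    by_contra hne
    obtain ⟨φ, hφ, hle⟩ := Submodule.exists_le_ker_of_lt_top _ (lt_top_iff_ne_top.mpr hne)
    apply hφ
    have hc : ∀ j, φ (Pi.single j 1) = 0 := by
      refine Fintype.linearIndependent_iff.mp ha _ (funext fun x => ?_)
      have hx : φ (fun j => a j x) = 0 := hle (Submodule.subset_span ⟨x, rfl⟩)
      rw [← Finset.univ_sum_single (fun j => a j x), map_sum] at hx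
      rw [Finset.sum_apply, Pi.zero_apply, ← hx]
      refine Finset.sum_congr rfl fun j _ => ?_
      rw [Pi.smul_apply, smul_eq_mul, mul_comm, ← smul_eq_mul, ← map_smul, ← Pi.single_smul,
        smul_eq_mul, mul_one]
    refine LinearMap.pi_ext' fun j => LinearMap.ext_ring ?_
    simpa using hc j
  obtain ⟨κ, s, -, hs, hli⟩ := exists_linearIndependent' ℂ fun x j => a j x
  let b := Module.Basis.mk hli (by rw [hs, hspan])
  have : Finite κ := Module.Finite.finite_basis b
  have : Fintype κ := Fintype.ofFinite κ
  have hcard : Fintype.card κ = n := by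
    simpa using (Module.finrank_eq_card_basis b).symm
  let e := Fintype.equivFinOfCardEq hcard
  refine ⟨s ∘ e.symm, ?_⟩
  rw [← isUnit_iff_ne_zero, ← Matrix.isUnit_iff_isUnit_det,
    ← Matrix.linearIndependent_rows_iff_isUnit]
  exact hli.comp e.symm e.symm.injective

/-- If the left factors of a sum of products of functions are linearly dependent, the sum can be
shortened by one term. -/
theorem exists_sum_mul_eq_of_not_linearIndependent {X Y : Type*} (P : Submodule ℂ (X → ℂ))
    (Q : Submodule ℂ (Y → ℂ)) {n : ℕ} {a : Fin (n + 1) → X → ℂ} {b : Fin (n + 1) → Y → ℂ}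
    (ha : ∀ j, a j ∈ P) (hb : ∀ j, b j ∈ Q) (hdep : ¬ LinearIndependent ℂ a) :
    ∃ (a' : Fin n → X → ℂ) (b' : Fin n → Y → ℂ), (∀ j, a' j ∈ P) ∧ (∀ j, b' j ∈ Q) ∧
      ∀ x y, ∑ j, a j x * b j y = ∑ j, a' j x * b' j y := by
  obtain ⟨c, hc, k, hk⟩ := Fintype.not_linearIndependent_iff.mp hdep
  refine ⟨fun j => a (k.succAbove j),
    fun j => b (k.succAbove j) - (c (k.succAbove j) / c k) • b k, fun j => ha _,
    fun j => Q.sub_mem (hb _) (Q.smul_mem _ (hb _)), fun x y => ?_⟩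
  have hx := congrFun hc x
  simp only [Finset.sum_apply, Pi.smul_apply, smul_eq_mul, Pi.zero_apply] at hx
  rw [Fin.sum_univ_succAbove _ k] at hx ⊢
  have hak : a k x = -∑ j, c (k.succAbove j) / c k * a (k.succAbove j) x := by
    simp only [div_mul_eq_mul_div, ← Finset.sum_div]
    field_simp
    linear_combination hx
  simp only [Pi.sub_apply, Pi.smul_apply, smul_eq_mul, mul_sub, Finset.sum_sub_distrib]
  rw [hak, neg_mul, Finset.sum_mul, neg_add_eq_sub]
  congr 1
  exact Finset.sum_congr rfl fun j _ => by ring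

/-- A finite sum of products of functions can be rewritten with linearly independent factors. -/
theorem exists_linearIndependent_sum_mul {X Y : Type*} (P : Submodule ℂ (X → ℂ))
    (Q : Submodule ℂ (Y → ℂ)) {n : ℕ} {a : Fin n → X → ℂ} {b : Fin n → Y → ℂ}
    (ha : ∀ j, a j ∈ P) (hb : ∀ j, b j ∈ Q) :
    ∃ (m : ℕ) (a' : Fin m → X → ℂ) (b' : Fin m → Y → ℂ), (∀ j, a' j ∈ P) ∧ (∀ j, b' j ∈ Q) ∧
      LinearIndependent ℂ a' ∧ LinearIndependent ℂ b' ∧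
      ∀ x y, ∑ j, a j x * b j y = ∑ j, a' j x * b' j y := by
  induction n with
  | zero => exact ⟨0, a, b, ha, hb, linearIndependent_empty_type, linearIndependent_empty_type,
      fun _ _ => rfl⟩
  | succ n ih =>
    by_cases hai : LinearIndependent ℂ a
    · by_cases hbi : LinearIndependent ℂ b
      · exact ⟨n + 1, a, b, ha, hb, hai, hbi, fun _ _ => rfl⟩
      · obtain ⟨b₁, a₁, hb₁, ha₁, h₁⟩ :=
          exists_sum_mul_eq_of_not_linearIndependent Q P hb ha hbi
        obtain ⟨m, a', b', ha', hb', hai', hbi', h'⟩ := ih ha₁ hb₁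
        refine ⟨m, a', b', ha', hb', hai', hbi', fun x y => ?_⟩
        rw [← h']
        simpa only [mul_comm] using h₁ y x
    · obtain ⟨a₁, b₁, ha₁, hb₁, h₁⟩ :=
        exists_sum_mul_eq_of_not_linearIndependent P Q ha hb hai
      obtain ⟨m, a', b', ha', hb', hai', hbi', h'⟩ := ih ha₁ hb₁
      exact ⟨m, a', b', ha', hb', hai', hbi', fun x y => (h₁ x y).trans (h' x y)⟩

/-- A finite sum of products of antiholomorphic and holomorphic functions which, along every
antidiagonal translation, tends to zero at infinity is empty once its factors are linearly
independent. -/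
theorem eq_zero_of_linearIndependent_of_tendsto {m : ℕ} {a b : Fin m → ℂ → ℂ}
    (ha : ∀ j, Differentiable ℂ (fun z => conj (a j z))) (hb : ∀ j, Differentiable ℂ (b j))
    (hai : LinearIndependent ℂ a) (hbi : LinearIndependent ℂ b)
    (hK : ∀ z z', Tendsto (fun u => ∑ j, a j (z + u) * b j (z' - u)) (cocompact ℂ) (𝓝 0)) :
    m = 0 := by
  by_contra hm
  obtain ⟨s, hs⟩ := exists_det_ne_zero_of_linearIndependent hai
  obtain ⟨t, ht⟩ := exists_det_ne_zero_of_linearIndependent hbi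
  set A : ℂ → Matrix (Fin m) (Fin m) ℂ := fun u => Matrix.of fun i j => a j (s i + u) with hA
  set B : ℂ → Matrix (Fin m) (Fin m) ℂ := fun u => Matrix.of fun i j => b j (t i - u) with hB
  have hdet : Tendsto (fun u => (A u).det * (B u).det) (cocompact ℂ) (𝓝 0) := by
    have hmat : Tendsto (fun u => A u * (B u).transpose) (cocompact ℂ) (𝓝 0) := by
      refine tendsto_pi_nhds.mpr fun i => tendsto_pi_nhds.mpr fun j => ?_
      simpa [Matrix.mul_apply, hA, hB] using hK (s i) (t j)
    have : Nonempty (Fin m) := ⟨⟨0, Nat.pos_of_ne_zero hm⟩⟩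
    have := ((continuous_id.matrix_det).tendsto _).comp hmat
    simpa [Function.comp_def, Matrix.det_mul, Matrix.det_zero] using this
  have hAd : Differentiable ℂ fun u => conj (A u).det := by
    simp only [Matrix.det_apply', map_sum, map_mul, map_prod, hA, Matrix.of_apply]
    refine Differentiable.fun_sum fun σ _ => Differentiable.mul (by simp) ?_
    refine Differentiable.fun_finsetProd fun i _ => ?_
    exact (ha i).comp (f := fun u => s (σ i) + u) (by fun_prop)
  have hBd : Differentiable ℂ fun u => (B u).det := by
    simp only [Matrix.det_apply', hB, Matrix.of_apply]
    refine Differentiable.fun_sum fun σ _ => Differentiable.mul (by simp) ?_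
    refine Differentiable.fun_finsetProd fun i _ => ?_
    exact (hb i).comp (f := fun u => t (σ i) - u) (by fun_prop)
  have h0 := (hAd.mul hBd).apply_eq_of_tendsto_cocompact 0 (c := 0) <| by
    rw [tendsto_zero_iff_norm_tendsto_zero] at hdet ⊢
    simpa using hdet
  simp only [Pi.mul_apply, mul_eq_zero, map_eq_zero] at h0
  rcases h0 with h0 | h0
  · exact hs (by simpa [hA] using h0)
  · exact ht (by simpa [hB] using h0)

/-- The entire functions, as a complex subspace of the space of all functions. -/
def entireSubmodule : Submodule ℂ (ℂ → ℂ) where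
  carrier := {h | Differentiable ℂ h}
  add_mem' := Differentiable.add
  zero_mem' := differentiable_const 0
  smul_mem' c _ h := Differentiable.const_smul h c

/-- The complex conjugates of entire functions, as a complex subspace of the space of all
functions. -/
def antientireSubmodule : Submodule ℂ (ℂ → ℂ) where
  carrier := {h | Differentiable ℂ fun z => conj (h z)}
  add_mem' h₁ h₂ := by simpa using! Differentiable.add h₁ h₂
  zero_mem' := by simp
  smul_mem' c _ h := by simpa using! Differentiable.const_mul h (conj c)

/-- A finite sum of products of antiholomorphic and holomorphic functions vanishes if it tends to
zero at infinity along every antidiagonal translation. -/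
theorem sum_conj_mul_eq_zero_of_tendsto {n : ℕ} {f g : Fin n → ℂ → ℂ}
    (hf : ∀ j, Differentiable ℂ (f j)) (hg : ∀ j, Differentiable ℂ (g j))
    (hK : ∀ z z', Tendsto (fun u => ∑ j, conj (g j (z + u)) * f j (z' - u)) (cocompact ℂ) (𝓝 0))
    (z z' : ℂ) : ∑ j, conj (g j z) * f j z' = 0 := by
  obtain ⟨m, a, b, ha, hb, hai, hbi, h⟩ := exists_linearIndependent_sum_mul
    antientireSubmodule entireSubmodule (a := fun j z => conj (g j z)) (b := f)
    (fun j => by simpa [antientireSubmodule] using! hg j) hf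
  obtain rfl := eq_zero_of_linearIndependent_of_tendsto ha hb hai hbi
    fun z z' => by simpa only [h] using hK z z'
  simpa using h z z'

theorem integrable_exp_neg_three_mul_norm :
    Integrable fun w : ℂ => Real.exp (-3 * ‖w‖) := by
  refine (integrable_one_add_norm (E := ℂ) (μ := volume) (r := 3)
    (by rw [Complex.finrank_real_complex]; norm_num)).mono' (by fun_prop) (.of_forall fun w => ?_)
  rw [Real.norm_of_nonneg (Real.exp_nonneg _), mul_comm, Real.exp_mul]
  exact Real.rpow_le_rpow_of_nonpos (by positivity)
    (by linarith [Real.add_one_le_exp ‖w‖]) (by norm_num)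

theorem MemDOneMinus.integrable_mul_exp {F : ℂ → ℂ} (hFmeas : Measurable F)
    (hF : MemDOneMinus F) (z z' : ℂ) :
    Integrable fun w : ℂ => F w * exp (w * conj z + conj w * z') * (Real.exp (-‖w‖ ^ 2) : ℂ) := by
  obtain ⟨C, hC⟩ := hF (‖z‖ + ‖z'‖ + 3) (by positivity)
  refine (integrable_exp_neg_three_mul_norm.const_mul C).mono' (by fun_prop)
    (.of_forall fun w => ?_)
  have hre : (w * conj z + conj w * z').re ≤ ‖w‖ * (‖z‖ + ‖z'‖) := by
    refine (re_le_norm _).trans ((norm_add_le _ _).trans_eq ?_)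
    simp only [norm_mul, RCLike.norm_conj]
    ring
  rw [norm_mul, norm_mul, norm_exp, norm_real, Real.norm_of_nonneg (Real.exp_nonneg _)]
  calc ‖F w‖ * Real.exp (w * conj z + conj w * z').re * Real.exp (-‖w‖ ^ 2)
      ≤ C * Real.exp (‖w‖ ^ 2 - (‖z‖ + ‖z'‖ + 3) * ‖w‖) * Real.exp (‖w‖ * (‖z‖ + ‖z'‖)) *
          Real.exp (-‖w‖ ^ 2) := by
        gcongr
        · exact (norm_nonneg _).trans (hC w)
        · exact hC w
    _ = C * Real.exp (-3 * ‖w‖) := by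
        rw [mul_assoc, mul_assoc, ← Real.exp_add, ← Real.exp_add]
        ring_nf

/-- An antidiagonal translation of the parameters of the weighted exponential kernel amounts to a
modulation. -/
theorem exp_antidiagonal_translate (F : ℂ → ℂ) (z z' u w : ℂ) :
    F w * exp (w * conj (z + u) + conj w * (z' - u)) * (Real.exp (-‖w‖ ^ 2) : ℂ) =
      Real.fourierChar (-inner ℝ w (-(I * u) / Real.pi)) •
        (F w * exp (w * conj z + conj w * z') * (Real.exp (-‖w‖ ^ 2) : ℂ)) := by
  have hexp : w * conj (z + u) + conj w * (z' - u) =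
      (w * conj z + conj w * z') +
        ↑(2 * Real.pi * -inner ℝ w (-(I * u) / Real.pi)) * I := by
    have hπ : (Real.pi : ℝ) ≠ 0 := Real.pi_ne_zero
    apply Complex.ext
    · simp [Complex.inner]; ring
    · simp [Complex.inner]; field_simp; ring
  rw [Circle.smul_def, Real.fourierChar_apply, hexp, Complex.exp_add, smul_eq_mul]
  ring

theorem finite_rank_theorem
    (F : ℂ → ℂ) (hFmeas : Measurable F) (hF : MemDOneMinus F)
    (N : ℕ) (f g : Fin N → ℂ → ℂ)
    (hf : ∀ j, Differentiable ℂ (f j)) (hg : ∀ j, Differentiable ℂ (g j))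
    (hfD : ∀ j, MemDOneMinus (f j)) (hgD : ∀ j, MemDOneMinus (g j))
    (hform : ∀ z z' : ℂ,
      (1 / (Real.pi : ℂ)) * ∫ w : ℂ, F w *
          Complex.exp (w * (starRingEnd ℂ) z + (starRingEnd ℂ) w * z') *
          (Real.exp (-‖w‖ ^ 2) : ℂ)
        = ∑ j, (starRingEnd ℂ) (g j z) * f j z') :
    F =ᵐ[volume] 0 := by
  have hπ : (Real.pi : ℂ) ≠ 0 := by exact_mod_cast Real.pi_ne_zero
  have hzero : ∀ z z', ∑ j, conj (g j z) * f j z' = 0 := by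
    refine sum_conj_mul_eq_zero_of_tendsto hf hg fun z z' => ?_
    have hu : Tendsto (fun u : ℂ => -(I * u) / Real.pi) (cocompact ℂ) (cocompact ℂ) := by
      have hc : -I / Real.pi ≠ 0 := div_ne_zero (neg_ne_zero.mpr I_ne_zero) hπ
      convert! (Homeomorph.mulLeft₀ _ hc).isClosedEmbedding.tendsto_cocompact using 2 with u
      simp only [Homeomorph.coe_mulLeft₀]
      ring
    have hRL := ((tendsto_integral_exp_inner_smul_cocompact fun w : ℂ =>
      F w * exp (w * conj z + conj w * z') * (Real.exp (-‖w‖ ^ 2) : ℂ)).comp hu).const_mul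
        (1 / (Real.pi : ℂ))
    rw [mul_zero] at hRL
    refine hRL.congr fun u => ?_
    rw [← hform]
    simp_rw [exp_antidiagonal_translate]
    rfl
  have hae := ae_eq_zero_of_fourier_eq_zero (hF.integrable_mul_exp hFmeas 0 0) fun ξ => by
    have h := hform (0 + I * Real.pi * ξ) (0 - I * Real.pi * ξ)
    rw [hzero, mul_eq_zero, or_iff_right (one_div_ne_zero hπ)] at h
    simp_rw [exp_antidiagonal_translate] at h
    have hξ : -(I * (I * Real.pi * ξ)) / Real.pi = ξ := by
      field_simp
      simp
    rwa [hξ] at h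
  filter_upwards [hae] with w hw
  simpa [Complex.exp_ne_zero] using hw
end

section
/- Let F : ℂ → ℂ be a measurable function in the class 𝔇_{1,-}, and let f_1,…,f_N, g_1,…,g_N : ℂ → ℂ be entire functions in 𝔇_{1,-}. Then the following are equivalent: (i) for all z, z' ∈ ℂ, (1/π) ∫_ℂ F(w) e^{w·conj(z) + conj(w)·z'} e^{−|w|²} dλ(w) = Σ_{j=1}^N conj(g_j(z)) f_j(z'); (ii) for all k, k' ∈ ℕ, (1/π) ∫_ℂ F(w) w^k conj(w)^{k'} e^{−|w|²} dλ(w) = Σ_{j=1}^N [(1/π) ∫_ℂ w^k conj(g_j(w)) e^{−|w|²} dλ(w)] · [(1/π) ∫_ℂ f_j(w) conj(w)^{k'} e^{−|w|²} dλ(w)]. -/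
open MeasureTheory Complex Filter

/-- `h` decays faster than every exponential: `|h w| ≤ C e^{-a|w|}` for every real `a`. -/
def ExpDecay (h : ℂ → ℂ) : Prop :=
  ∀ a : ℝ, ∃ C : ℝ, ∀ w : ℂ, ‖h w‖ ≤ C * Real.exp (-(a * ‖w‖))

/-- Multiplying by the Gaussian weight turns the class `𝔇_{1,-}` into `ExpDecay`. -/
lemma MemDOneMinus.expDecay {h : ℂ → ℂ} (hh : MemDOneMinus h) :
    ExpDecay (fun w => h w * (Real.exp (-‖w‖ ^ 2) : ℂ)) := by
  intro a
  obtain ⟨C, hC⟩ := hh (max a 1) (by positivity)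
  have hC0 : 0 ≤ C := by
    have := (norm_nonneg _).trans (hC 0)
    simpa using this
  refine ⟨C, fun w => ?_⟩
  rw [norm_mul, norm_real, Real.norm_of_nonneg (Real.exp_nonneg _)]
  calc ‖h w‖ * Real.exp (-‖w‖ ^ 2)
      ≤ C * Real.exp (‖w‖ ^ 2 - max a 1 * ‖w‖) * Real.exp (-‖w‖ ^ 2) := by
        gcongr
        exact hC w
    _ = C * Real.exp (-(max a 1 * ‖w‖)) := by
        rw [mul_assoc, ← Real.exp_add]
        ring_nf
    _ ≤ C * Real.exp (-(a * ‖w‖)) := by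
        gcongr
        exact le_max_left _ _

lemma ExpDecay.mul {h m : ℂ → ℂ} (hh : ExpDecay h) {D b : ℝ}
    (hm : ∀ w, ‖m w‖ ≤ D * Real.exp (b * ‖w‖)) : ExpDecay (fun w => h w * m w) := by
  intro a
  obtain ⟨C, hC⟩ := hh (a + b)
  refine ⟨C * D, fun w => ?_⟩
  rw [norm_mul]
  calc ‖h w‖ * ‖m w‖
      ≤ (C * Real.exp (-((a + b) * ‖w‖))) * (D * Real.exp (b * ‖w‖)) :=
        mul_le_mul (hC w) (hm w) (norm_nonneg _) ((norm_nonneg _).trans (hC w))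
    _ = C * D * (Real.exp (-((a + b) * ‖w‖)) * Real.exp (b * ‖w‖)) := by ring
    _ = C * D * Real.exp (-(a * ‖w‖)) := by
        rw [← Real.exp_add]
        ring_nf

lemma ExpDecay.mul_pow {h u : ℂ → ℂ} (hh : ExpDecay h) (hu : ∀ w, ‖u w‖ = ‖w‖) (k : ℕ) :
    ExpDecay (fun w => h w * u w ^ k) := by
  refine hh.mul (D := k.factorial) (b := 1) fun w => ?_
  have := Real.pow_div_factorial_le_exp ‖w‖ (norm_nonneg w) k
  rw [div_le_iff₀ (by positivity)] at this
  rw [norm_pow, hu, one_mul]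
  linarith

lemma ExpDecay.mul_exp {h u : ℂ → ℂ} (hh : ExpDecay h) (hu : ∀ w, ‖u w‖ = ‖w‖) (ζ : ℂ) :
    ExpDecay (fun w => h w * Complex.exp (u w * ζ)) := by
  refine hh.mul (D := 1) (b := ‖ζ‖) fun w => ?_
  rw [one_mul]
  refine (Complex.norm_exp_le_exp_norm _).trans ?_
  rw [norm_mul, hu, mul_comm]

lemma integrable_exp_neg_mul_norm {a : ℝ} (ha : 3 ≤ a) :
    Integrable (fun w : ℂ => Real.exp (-(a * ‖w‖))) := by
  have h3 : (Module.finrank ℝ ℂ : ℝ) < 3 := by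
    rw [Complex.finrank_real_complex]
    norm_num
  refine (integrable_one_add_norm (μ := (volume : Measure ℂ)) h3).mono'
    (by fun_prop) (ae_of_all _ fun w => ?_)
  rw [Real.norm_of_nonneg (Real.exp_nonneg _), Real.rpow_neg (by positivity), Real.exp_neg]
  gcongr
  rw [mul_comm a, Real.exp_mul]
  have hw : 1 + ‖w‖ ≤ Real.exp ‖w‖ := by linarith [Real.add_one_le_exp ‖w‖]
  calc (1 + ‖w‖) ^ (3 : ℝ) ≤ (1 + ‖w‖) ^ a :=
        Real.rpow_le_rpow_of_exponent_le (by linarith [norm_nonneg w]) ha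
    _ ≤ _ := Real.rpow_le_rpow (by positivity) hw (by linarith)

lemma ExpDecay.integrable {h : ℂ → ℂ} (hh : ExpDecay h) (hm : Measurable h) :
    Integrable h := by
  obtain ⟨C, hC⟩ := hh 3
  exact ((integrable_exp_neg_mul_norm le_rfl).const_mul C).mono'
    hm.aestronglyMeasurable (ae_of_all _ hC)

/-- The exponential transform of `h` is the power series built from its moments. -/
lemma ExpDecay.hasSum_moments {h u : ℂ → ℂ} (hh : ExpDecay h) (hm : Measurable h)
    (hum : Measurable u) (hu : ∀ w, ‖u w‖ = ‖w‖) (ζ : ℂ) :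
    HasSum (fun k : ℕ => ζ ^ k * ((k.factorial : ℂ)⁻¹ * ∫ w, h w * u w ^ k))
      (∫ w, h w * Complex.exp (u w * ζ)) := by
  have hexp : ∀ w, HasSum (fun k : ℕ => ‖h w‖ * ((‖w‖ * ‖ζ‖) ^ k / k.factorial))
      (‖h w‖ * Real.exp (‖w‖ * ‖ζ‖)) := fun w => by
    have := NormedSpace.expSeries_div_hasSum_exp (‖w‖ * ‖ζ‖)
    rw [← Real.exp_eq_exp_ℝ] at this
    exact this.mul_left _
  have key := hasSum_integral_of_dominated_convergence (μ := (volume : Measure ℂ))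
    (F := fun (k : ℕ) w => h w * ((u w * ζ) ^ k / k.factorial))
    (f := fun w => h w * Complex.exp (u w * ζ))
    (fun k w => ‖h w‖ * ((‖w‖ * ‖ζ‖) ^ k / k.factorial))
    (fun k => (by fun_prop : Measurable _).aestronglyMeasurable)
    (fun k => ae_of_all _ fun w => by simp [hu])
    (ae_of_all _ fun w => (hexp w).summable) ?_
    (ae_of_all _ fun w => ?_)
  · refine key.congr_fun fun k => ?_
    rw [← mul_assoc, ← integral_const_mul]
    congr 1 with w
    ring
  · simp_rw [fun w => (hexp w).tsum_eq]
    have := (hh.mul_exp (u := fun w => (‖w‖ : ℂ)) (by simp) (‖ζ‖ : ℂ)).integrable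
      (by fun_prop)
    refine this.norm.congr (ae_of_all _ fun w => ?_)
    simp [Complex.norm_exp]
  · have := NormedSpace.expSeries_div_hasSum_exp (u w * ζ)
    rw [← Complex.exp_eq_exp_ℂ] at this
    exact this.mul_left _

/-- Two everywhere convergent power series have the same sum iff their coefficients agree. -/
lemma forall_eq_iff_coeff_eq {A B : ℂ → ℂ} {c d : ℕ → ℂ}
    (hA : ∀ ζ, HasSum (fun k => ζ ^ k * c k) (A ζ))
    (hB : ∀ ζ, HasSum (fun k => ζ ^ k * d k) (B ζ)) :
    (∀ ζ, A ζ = B ζ) ↔ ∀ k, c k = d k := by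
  have aux : ∀ {A : ℂ → ℂ} {c : ℕ → ℂ}, (∀ ζ, HasSum (fun k => ζ ^ k * c k) (A ζ)) →
      HasFPowerSeriesAt A (FormalMultilinearSeries.ofScalars ℂ c) 0 := by
    intro A c hA
    rw [hasFPowerSeriesAt_iff]
    refine Eventually.of_forall fun z => ?_
    simpa using hA z
  constructor
  · intro h k
    obtain rfl : A = B := funext h
    have := (aux hA).eq_formalMultilinearSeries (aux hB)
    simpa using congrArg (fun p => p.coeff k) this
  · intro h ζ
    obtain rfl : c = d := funext h
    exact (hA ζ).unique (hB ζ)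

lemma hasSum_taylor_zero {f : ℂ → ℂ} (hf : Differentiable ℂ f) (z : ℂ) :
    HasSum (fun k : ℕ => z ^ k * ((k.factorial : ℂ)⁻¹ * iteratedDeriv k f 0)) (f z) := by
  have := Complex.hasSum_taylorSeries_of_entire hf 0 z
  refine this.congr_fun fun k => ?_
  simp only [sub_zero, smul_eq_mul]
  ring

/-- Rotational averages of an entire function against characters are Taylor coefficients. -/
lemma integral_rotation_eq_iteratedDeriv {f : ℂ → ℂ} (hf : Differentiable ℂ f) (k : ℕ) (w : ℂ) :
    ∫ θ : ℝ in 0..2 * Real.pi,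
        f (Complex.exp (θ * I) * w) * (starRingEnd ℂ) (Complex.exp (θ * I)) ^ k
      = 2 * Real.pi / k.factorial * (w ^ k * iteratedDeriv k f 0) := by
  have hg : Differentiable ℂ (fun ζ => f (w * ζ)) := by fun_prop
  have h := (hg.differentiableOn
    (s := Metric.closedBall 0 1)).circleIntegral_one_div_sub_center_pow_smul one_pos k
  rw [iteratedDeriv_comp_const_mul hf.contDiff, circleIntegral] at h
  have h2 : ∀ θ : ℝ, deriv (circleMap 0 1) θ •
      ((1 / (circleMap 0 1 θ - 0) ^ (k + 1)) • f (w * circleMap 0 1 θ))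
      = I * (f (Complex.exp (θ * I) * w) * (starRingEnd ℂ) (Complex.exp (θ * I)) ^ k) := by
    intro θ
    have hne := Complex.exp_ne_zero (θ * I)
    have hc : (starRingEnd ℂ) (Complex.exp (θ * I)) = (Complex.exp (θ * I))⁻¹ := by
      rw [← Complex.exp_conj, ← Complex.exp_neg]
      simp
    simp only [deriv_circleMap, circleMap, hc, smul_eq_mul, ofReal_one, one_mul, zero_add,
      sub_zero, mul_comm w]
    generalize Complex.exp (θ * I) = e at hne
    rw [inv_pow]
    field_simp
    ring
  simp_rw [h2, intervalIntegral.integral_const_mul] at h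
  refine mul_left_cancel₀ I_ne_zero (h.trans ?_)
  simp only [mul_zero, smul_eq_mul]
  ring

lemma integral_normSq_pow_mul_gaussian (k : ℕ) :
    ∫ w : ℂ, w ^ k * (starRingEnd ℂ) w ^ k * (Real.exp (-‖w‖ ^ 2) : ℂ)
      = Real.pi * k.factorial := by
  have h := Complex.integral_rpow_mul_exp_neg_rpow (p := 2) (q := 2 * k) one_le_two
    (by have : (0 : ℝ) ≤ k := k.cast_nonneg
        linarith)
  rw [show ((2 * k + 2 : ℝ) / 2) = k + 1 by ring, Real.Gamma_nat_eq_factorial] at h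
  rw [show (2 * Real.pi / 2 * k.factorial : ℝ) = Real.pi * k.factorial by ring] at h
  have h' := congrArg (fun x : ℝ => (x : ℂ)) h
  simp only [← integral_complex_ofReal] at h'
  push_cast at h'
  rw [← h']
  congr 1 with w
  rw [← mul_pow, Complex.mul_conj', ← pow_mul]
  norm_cast

lemma integral_comp_circle_mul (h : ℂ → ℂ) (θ : ℝ) :
    ∫ w, h (Complex.exp (θ * I) * w) = ∫ w, h w := by
  have := (rotation (Circle.exp θ)).measurePreserving.integral_comp
    (rotation (Circle.exp θ)).toHomeomorph.measurableEmbedding h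
  simpa [rotation_apply] using this

/-- The pairing of an entire function of class `𝔇_{1,-}` with a monomial is a derivative at `0`. -/
lemma integral_mul_conj_pow_gaussian {f : ℂ → ℂ} (hf : Differentiable ℂ f) (hfD : MemDOneMinus f)
    (k : ℕ) :
    (1 / (Real.pi : ℂ)) * ∫ w : ℂ, f w * (starRingEnd ℂ) w ^ k * (Real.exp (-‖w‖ ^ 2) : ℂ)
      = iteratedDeriv k f 0 := by
  set J := ∫ w : ℂ, f w * (starRingEnd ℂ) w ^ k * (Real.exp (-‖w‖ ^ 2) : ℂ) with hJ
  have hcont := hf.continuous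
  let G : ℝ → ℂ → ℂ := fun θ w => f (Complex.exp (θ * I) * w) *
    (starRingEnd ℂ) (Complex.exp (θ * I) * w) ^ k * (Real.exp (-‖w‖ ^ 2) : ℂ)
  have hrot : ∀ θ, ∫ w, G θ w = J := fun θ => by
    refine Eq.trans ?_ (integral_comp_circle_mul
      (fun w => f w * (starRingEnd ℂ) w ^ k * (Real.exp (-‖w‖ ^ 2) : ℂ)) θ)
    simp [G]
  have hdecay : ExpDecay
      (fun w => f w * (starRingEnd ℂ) w ^ k * (Real.exp (-‖w‖ ^ 2) : ℂ)) := by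
    simpa only [mul_right_comm] using
      hfD.expDecay.mul_pow (u := starRingEnd ℂ) (fun w => Complex.norm_conj w) k
  have hint : Integrable (Function.uncurry G)
      ((volume.restrict (Set.uIoc 0 (2 * Real.pi))).prod volume) := by
    have : IsFiniteMeasure (volume.restrict (Set.uIoc 0 (2 * Real.pi))) :=
      Real.isFiniteMeasure_restrict_Ioc _ _
    obtain ⟨C, hC⟩ := hdecay 3
    have hb := ((integrable_exp_neg_mul_norm le_rfl).const_mul C).comp_snd
      (volume.restrict (Set.uIoc 0 (2 * Real.pi)))
    refine hb.mono' ?_ (ae_of_all _ fun p => ?_)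
    · refine Continuous.aestronglyMeasurable ?_
      simp only [G, Function.uncurry_def]
      fun_prop
    · have := hC (Complex.exp (p.1 * I) * p.2)
      simpa [G, Function.uncurry_def] using this
  have hswap := intervalIntegral_integral_swap hint
  simp_rw [hrot] at hswap
  have hinner : ∀ w, ∫ θ in 0..2 * Real.pi, G θ w
      = 2 * Real.pi / k.factorial * iteratedDeriv k f 0 *
        (w ^ k * (starRingEnd ℂ) w ^ k * (Real.exp (-‖w‖ ^ 2) : ℂ)) := fun w => by
    have h1 : ∀ θ : ℝ, G θ w = (f (Complex.exp (θ * I) * w) *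
        (starRingEnd ℂ) (Complex.exp (θ * I)) ^ k) *
        ((starRingEnd ℂ) w ^ k * (Real.exp (-‖w‖ ^ 2) : ℂ)) := fun θ => by
      simp only [G, map_mul, mul_pow]
      ring
    simp_rw [h1]
    rw [intervalIntegral.integral_mul_const, integral_rotation_eq_iteratedDeriv hf]
    ring
  simp_rw [hinner] at hswap
  rw [integral_const_mul, integral_normSq_pow_mul_gaussian, intervalIntegral.integral_const,
    Complex.real_smul] at hswap
  have hpi : (Real.pi : ℂ) ≠ 0 := ofReal_ne_zero.mpr Real.pi_ne_zero
  have hk : (k.factorial : ℂ) ≠ 0 := Nat.cast_ne_zero.mpr k.factorial_ne_zero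
  push_cast at hswap
  field_simp at hswap ⊢
  refine mul_left_cancel₀ (mul_ne_zero two_ne_zero hpi) ?_
  linear_combination hswap

lemma integral_pow_mul_conj_gaussian {g : ℂ → ℂ} (hg : Differentiable ℂ g) (hgD : MemDOneMinus g)
    (k : ℕ) :
    (1 / (Real.pi : ℂ)) * ∫ w : ℂ, w ^ k * (starRingEnd ℂ) (g w) * (Real.exp (-‖w‖ ^ 2) : ℂ)
      = (starRingEnd ℂ) (iteratedDeriv k g 0) := by
  rw [← integral_mul_conj_pow_gaussian hg hgD, map_mul, ← integral_conj]
  simp [mul_comm (starRingEnd ℂ (g _)), -ofReal_exp]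

theorem finite_rank_on_kernels_iff_on_polynomials
    (F : ℂ → ℂ) (hFmeas : Measurable F) (hF : MemDOneMinus F)
    (N : ℕ) (f g : Fin N → ℂ → ℂ)
    (hf : ∀ j, Differentiable ℂ (f j)) (hg : ∀ j, Differentiable ℂ (g j))
    (hfD : ∀ j, MemDOneMinus (f j)) (hgD : ∀ j, MemDOneMinus (g j)) :
    (∀ z z' : ℂ,
      (1 / (Real.pi : ℂ)) * ∫ w : ℂ, F w *
          Complex.exp (w * (starRingEnd ℂ) z + (starRingEnd ℂ) w * z') *
          (Real.exp (-‖w‖ ^ 2) : ℂ)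
        = ∑ j, (starRingEnd ℂ) (g j z) * f j z')
    ↔
    (∀ k k' : ℕ,
      (1 / (Real.pi : ℂ)) * ∫ w : ℂ, F w * w ^ k * ((starRingEnd ℂ) w) ^ k' *
          (Real.exp (-‖w‖ ^ 2) : ℂ)
        = ∑ j,
          ((1 / (Real.pi : ℂ)) * ∫ w : ℂ, w ^ k * (starRingEnd ℂ) (g j w) *
              (Real.exp (-‖w‖ ^ 2) : ℂ)) *
          ((1 / (Real.pi : ℂ)) * ∫ w : ℂ, f j w * ((starRingEnd ℂ) w) ^ k' *
              (Real.exp (-‖w‖ ^ 2) : ℂ))) := by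
  have hpi : (1 / (Real.pi : ℂ)) ≠ 0 := one_div_ne_zero (ofReal_ne_zero.mpr Real.pi_ne_zero)
  have hconj : ∀ w : ℂ, ‖(starRingEnd ℂ) w‖ = ‖w‖ := Complex.norm_conj
  have hconjm : Measurable (starRingEnd ℂ : ℂ → ℂ) := Complex.continuous_conj.measurable
  let μ : ℂ → ℂ := fun w => F w * (Real.exp (-‖w‖ ^ 2) : ℂ)
  have hμ : ExpDecay μ := hF.expDecay
  have hμm : Measurable μ := by fun_prop
  simp_rw [fun j k => integral_mul_conj_pow_gaussian (hf j) (hfD j) k,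
    fun j k => integral_pow_mul_conj_gaussian (hg j) (hgD j) k]
  have hfac : ∀ k : ℕ, ((k.factorial : ℂ)⁻¹) ≠ 0 := fun k =>
    inv_ne_zero (Nat.cast_ne_zero.mpr k.factorial_ne_zero)
  have hfirst : ∀ z', (∀ ζ, (1 / (Real.pi : ℂ)) *
        ∫ w, μ w * Complex.exp ((starRingEnd ℂ) w * z') * Complex.exp (w * ζ)
        = ∑ j, (starRingEnd ℂ) (g j ((starRingEnd ℂ) ζ)) * f j z') ↔
      ∀ k : ℕ, (1 / (Real.pi : ℂ)) * ∫ w, μ w * w ^ k * Complex.exp ((starRingEnd ℂ) w * z')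
        = ∑ j, (starRingEnd ℂ) (iteratedDeriv k (g j) 0) * f j z' := by
    intro z'
    rw [forall_eq_iff_coeff_eq
      (c := fun k => (k.factorial : ℂ)⁻¹ * ((1 / (Real.pi : ℂ)) *
        ∫ w, μ w * w ^ k * Complex.exp ((starRingEnd ℂ) w * z')))
      (d := fun k => (k.factorial : ℂ)⁻¹ *
        ∑ j, (starRingEnd ℂ) (iteratedDeriv k (g j) 0) * f j z')]
    · exact forall_congr' fun k => mul_right_inj' (hfac k)
    · intro ζ
      have := ((hμ.mul_exp hconj z').hasSum_moments (u := fun w => w) (by fun_prop)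
        measurable_id (fun _ => rfl) ζ).mul_left (1 / (Real.pi : ℂ))
      refine this.congr_fun fun k => ?_
      simp only [mul_right_comm (μ _)]
      ring
    · intro ζ
      have := hasSum_sum (s := Finset.univ) fun j _ =>
        (((Complex.hasSum_conj'.mpr (hasSum_taylor_zero (hg j) ((starRingEnd ℂ) ζ)))).mul_right
          (f j z'))
      refine this.congr_fun fun k => ?_
      simp only [Finset.mul_sum, map_mul, map_pow, Complex.conj_conj, map_inv₀, map_natCast]
      exact Finset.sum_congr rfl fun j _ => by ring
  have hsecond : ∀ k : ℕ, (∀ z', (1 / (Real.pi : ℂ)) *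
        ∫ w, μ w * w ^ k * Complex.exp ((starRingEnd ℂ) w * z')
        = ∑ j, (starRingEnd ℂ) (iteratedDeriv k (g j) 0) * f j z') ↔
      ∀ k' : ℕ, (1 / (Real.pi : ℂ)) * ∫ w, μ w * w ^ k * (starRingEnd ℂ) w ^ k'
        = ∑ j, (starRingEnd ℂ) (iteratedDeriv k (g j) 0) * iteratedDeriv k' (f j) 0 := by
    intro k
    rw [forall_eq_iff_coeff_eq
      (c := fun k' => (k'.factorial : ℂ)⁻¹ * ((1 / (Real.pi : ℂ)) *
        ∫ w, μ w * w ^ k * (starRingEnd ℂ) w ^ k'))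
      (d := fun k' => (k'.factorial : ℂ)⁻¹ *
        ∑ j, (starRingEnd ℂ) (iteratedDeriv k (g j) 0) * iteratedDeriv k' (f j) 0)]
    · exact forall_congr' fun k' => mul_right_inj' (hfac k')
    · intro z'
      have := ((hμ.mul_pow (u := fun w => w) (fun _ => rfl) k).hasSum_moments (by fun_prop)
        hconjm hconj z').mul_left (1 / (Real.pi : ℂ))
      refine this.congr_fun fun k' => ?_
      ring
    · intro z'
      have := hasSum_sum (s := Finset.univ) fun j _ =>
        (hasSum_taylor_zero (hf j) z').mul_left ((starRingEnd ℂ) (iteratedDeriv k (g j) 0))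
      refine this.congr_fun fun k' => ?_
      simp only [Finset.mul_sum]
      exact Finset.sum_congr rfl fun j _ => by ring
  have hker : ∀ z z' : ℂ, ∫ w : ℂ, F w *
        Complex.exp (w * (starRingEnd ℂ) z + (starRingEnd ℂ) w * z') *
        (Real.exp (-‖w‖ ^ 2) : ℂ)
      = ∫ w, μ w * Complex.exp ((starRingEnd ℂ) w * z') *
          Complex.exp (w * (starRingEnd ℂ) z) := fun z z' => by
    congr 1 with w
    rw [Complex.exp_add]
    ring
  have hmon : ∀ k k' : ℕ, ∫ w : ℂ, F w * w ^ k * (starRingEnd ℂ) w ^ k' *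
        (Real.exp (-‖w‖ ^ 2) : ℂ) = ∫ w, μ w * w ^ k * (starRingEnd ℂ) w ^ k' :=
    fun k k' => by
      congr 1 with w
      ring
  simp_rw [hker, hmon, ← hsecond]
  rw [forall_comm, forall_comm (α := ℕ)]
  refine forall_congr' fun z' => ?_
  rw [← hfirst]
  exact ⟨fun h ζ => by simpa using h ((starRingEnd ℂ) ζ),
    fun h z => by simpa using h ((starRingEnd ℂ) z)⟩
end

section
/- Let u : ℂ → ℂ be an entire function with ∫_ℂ |u(w)|² e^{−|w|²} dλ(w) < ∞. Then for every z ∈ ℂ, the function w ↦ e^{z·conj(w)} u(w) e^{−|w|²} is integrable on ℂ and u(z) = (1/π) ∫_ℂ e^{z·conj(w)} u(w) e^{−|w|²} dλ(w). -/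
open MeasureTheory Complex Filter

theorem integral_exp_neg_norm_sq : ∫ w : ℂ, Real.exp (-‖w‖ ^ 2) = Real.pi := by
  have h := Complex.integral_exp_neg_rpow (p := 2) (by norm_num)
  norm_num at h
  exact h

theorem integrable_exp_neg_norm_sq : Integrable fun w : ℂ => Real.exp (-‖w‖ ^ 2) :=
  Integrable.of_integral_ne_zero (integral_exp_neg_norm_sq ▸ Real.pi_ne_zero)

/-- The mean value property of an entire function over circles centred at the origin. -/
theorem integral_entire_circle {g : ℂ → ℂ} (hg : Differentiable ℂ g) (v : ℂ) :
    ∫ θ in (0 : ℝ)..2 * Real.pi, g (circleMap 0 1 θ * v) = 2 * Real.pi * g 0 := by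
  have hd : Differentiable ℂ fun ζ : ℂ => g (ζ * v) := by fun_prop
  have h := (hd.diffContOnCl (s := Metric.ball 0 |1|)).circleAverage
  rw [Real.circleAverage, inv_smul_eq_iff₀ (by positivity)] at h
  simpa using h

/-- The mean value property of an entire function for the Gaussian measure. -/
theorem integral_entire_mul_gaussian {g : ℂ → ℂ} (hg : Differentiable ℂ g)
    (hi : Integrable fun v : ℂ => g v * (Real.exp (-‖v‖ ^ 2) : ℂ)) :
    ∫ v : ℂ, g v * (Real.exp (-‖v‖ ^ 2) : ℂ) = Real.pi * g 0 := by
  set f : ℂ → ℂ := fun v => g v * (Real.exp (-‖v‖ ^ 2) : ℂ) with hf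
  have hfc : Continuous f := by
    have := hg.continuous
    fun_prop
  have hmp (θ : ℝ) : MeasurePreserving (fun v : ℂ => circleMap 0 1 θ * v) := by
    have h := (rotation (Circle.exp θ)).measurePreserving
    convert h using 2
    simp [circleMap]
  have hme (θ : ℝ) : MeasurableEmbedding (fun v : ℂ => circleMap 0 1 θ * v) :=
    measurableEmbedding_mulLeft₀ (circleMap_ne_center one_ne_zero)
  have hrot : ∀ {E : Type} [NormedAddCommGroup E] [NormedSpace ℝ E] (F : ℂ → E) (θ : ℝ),
      ∫ v, F (circleMap 0 1 θ * v) = ∫ v, F v := fun F θ => (hmp θ).integral_comp (hme θ) F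
  have hprod : Integrable (Function.uncurry fun (θ : ℝ) (v : ℂ) => f (circleMap 0 1 θ * v))
      ((volume.restrict (Set.uIoc 0 (2 * Real.pi))).prod volume) := by
    refine (integrable_prod_iff ?_).2 ⟨?_, ?_⟩
    · refine Continuous.aestronglyMeasurable ?_
      simp only [Function.uncurry_def]
      have := continuous_circleMap 0 1
      fun_prop
    · exact .of_forall fun θ => (hmp θ).integrable_comp_of_integrable hi
    · simp only [Function.uncurry_apply_pair, hrot (fun v => ‖f v‖)]
      rw [Set.uIoc_of_le Real.two_pi_pos.le]
      exact integrable_const _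
  have hswap := intervalIntegral_integral_swap hprod
  have hinner (v : ℂ) : ∫ θ in (0 : ℝ)..2 * Real.pi, f (circleMap 0 1 θ * v)
      = 2 * Real.pi * g 0 * (Real.exp (-‖v‖ ^ 2) : ℂ) := by
    simp only [hf, norm_mul, norm_circleMap_zero, abs_one, one_mul]
    rw [intervalIntegral.integral_mul_const, integral_entire_circle hg]
  have hgauss : ∫ v : ℂ, (Real.exp (-‖v‖ ^ 2) : ℂ) = Real.pi := by
    rw [integral_complex_ofReal, integral_exp_neg_norm_sq]
  simp only [hrot f, hinner, intervalIntegral.integral_const, integral_const_mul,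
    hgauss] at hswap
  have hpi : (Real.pi : ℂ) ≠ 0 := by exact_mod_cast Real.pi_ne_zero
  refine mul_left_cancel₀ (mul_ne_zero two_ne_zero hpi) ?_
  simp only [sub_zero, real_smul, ofReal_mul, ofReal_ofNat] at hswap
  linear_combination hswap

theorem integrable_fock_kernel_mul {u : ℂ → ℂ} (hu : Continuous u)
    (huL2 : Integrable (fun w : ℂ => ‖u w‖ ^ 2 * Real.exp (-‖w‖ ^ 2))) (z : ℂ) :
    Integrable fun w : ℂ =>
      Complex.exp (z * (starRingEnd ℂ) w) * u w * (Real.exp (-‖w‖ ^ 2) : ℂ) := by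
  have hgauss := (integrable_exp_neg_norm_sq.comp_sub_right z).const_mul (Real.exp (‖z‖ ^ 2))
  refine (huL2.add hgauss).mono' ?_ (.of_forall fun w => ?_)
  · refine Continuous.aestronglyMeasurable ?_
    have := continuous_conj
    fun_prop
  · have hexp : Real.exp (‖z‖ ^ 2) * Real.exp (-‖w - z‖ ^ 2)
        = Real.exp (z * (starRingEnd ℂ) w).re ^ 2 * Real.exp (-‖w‖ ^ 2) := by
      rw [← Real.exp_nat_mul, ← Real.exp_add, ← Real.exp_add]
      congr 1
      simp only [← normSq_eq_norm_sq, normSq_apply, mul_re, conj_re, conj_im, sub_re, sub_im]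
      push_cast
      ring
    simp only [Pi.add_apply, hexp, norm_mul, norm_exp, norm_real, Real.norm_eq_abs, Real.abs_exp]
    rw [← add_mul]
    gcongr
    nlinarith [sq_nonneg (Real.exp (z * (starRingEnd ℂ) w).re - ‖u w‖),
      sq_nonneg (Real.exp (z * (starRingEnd ℂ) w).re), sq_nonneg ‖u w‖]

theorem fock_kernel_mul_translate (u : ℂ → ℂ) (z v : ℂ) :
    Complex.exp (z * (starRingEnd ℂ) (v + z)) * u (v + z) * (Real.exp (-‖v + z‖ ^ 2) : ℂ)
      = Complex.exp (-((starRingEnd ℂ) z * v)) * u (v + z) * (Real.exp (-‖v‖ ^ 2) : ℂ) := by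
  rw [mul_right_comm, mul_right_comm _ (u _)]
  congr 1
  push_cast
  rw [← Complex.exp_add, ← Complex.exp_add, ← Complex.mul_conj', ← Complex.mul_conj']
  congr 1
  simp only [map_add]
  ring

theorem fock_reproducing_property
    (u : ℂ → ℂ) (hu : Differentiable ℂ u)
    (huL2 : Integrable (fun w : ℂ => ‖u w‖ ^ 2 * Real.exp (-‖w‖ ^ 2))) :
    ∀ z : ℂ,
      Integrable (fun w : ℂ =>
        Complex.exp (z * (starRingEnd ℂ) w) * u w * (Real.exp (-‖w‖ ^ 2) : ℂ)) ∧
      u z = (1 / (Real.pi : ℂ)) * ∫ w : ℂ,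
        Complex.exp (z * (starRingEnd ℂ) w) * u w * (Real.exp (-‖w‖ ^ 2) : ℂ) := by
  intro z
  have hi := integrable_fock_kernel_mul hu.continuous huL2 z
  refine ⟨hi, ?_⟩
  have hi' := hi.comp_add_right z
  simp only [fock_kernel_mul_translate] at hi'
  have hg : Differentiable ℂ fun v : ℂ => Complex.exp (-((starRingEnd ℂ) z * v)) * u (v + z) := by
    fun_prop
  have hpi : (Real.pi : ℂ) ≠ 0 := by exact_mod_cast Real.pi_ne_zero
  rw [← integral_add_right_eq_self _ z]
  simp only [fock_kernel_mul_translate]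
  rw [integral_entire_mul_gaussian hg hi']
  simp [hpi]
end

section
/- Let f : ℂ → ℂ be an entire function in the class 𝔇_{1,-}, i.e., for every a > 0 there is a constant C_a with |f(z)| ≤ C_a e^{|z|² − a|z|} for all z ∈ ℂ. Then for every α ∈ ℕ and every z ∈ ℂ, the α-th derivative of f satisfies f^{(α)}(z) = (1/π) ∫_ℂ conj(w)^α e^{z·conj(w)} f(w) e^{−|w|²} dλ(w), the integrand being integrable on ℂ. -/
open MeasureTheory Complex Filter

/-- Integrability of a continuous function on `ℂ` passes to polar coordinates. -/
theorem integrableOn_polarCoord_target_of_integrable {F : ℂ → ℂ} (hc : Continuous F)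
    (hF : Integrable F) :
    IntegrableOn (fun p : ℝ × ℝ => p.1 • F (Complex.polarCoord.symm p)) polarCoord.target := by
  refine ⟨?_, ?_⟩
  · have h : Continuous fun p : ℝ × ℝ => p.1 • F (Complex.polarCoord.symm p) := by
      simp only [Complex.polarCoord_symm_apply]
      fun_prop
    exact h.aestronglyMeasurable
  · have h : ∫⁻ p in polarCoord.target, ‖p.1 • F (Complex.polarCoord.symm p)‖ₑ
        = ∫⁻ u, ‖F u‖ₑ := by
      rw [← Complex.lintegral_comp_polarCoord_symm]
      refine setLIntegral_congr_fun polarCoord.open_target.measurableSet fun p hp => ?_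
      have hp : 0 < p.1 := hp.1
      rw [enorm_smul, Real.enorm_eq_ofReal hp.le, smul_eq_mul]
    rw [HasFiniteIntegral, h]
    exact hF.2

/-- The mean value property on a circle centred at the origin, parametrized by `(-π, π)`. -/
theorem integral_polarCoord_symm_eq {g : ℂ → ℂ} (hg : Differentiable ℂ g) (r : ℝ) :
    ∫ θ in Set.Ioo (-Real.pi) Real.pi, g (Complex.polarCoord.symm (r, θ)) =
      2 * Real.pi * g 0 := by
  have h : Real.circleAverage g 0 r = g 0 := hg.diffContOnCl.circleAverage
  have hper : (fun θ => g (circleMap 0 r θ)).Periodic (2 * Real.pi) :=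
    fun x => by simp [periodic_circleMap 0 r x]
  have h' := hper.intervalIntegral_add_eq 0 (-Real.pi)
  rw [Real.circleAverage_def] at h
  rw [zero_add, show -Real.pi + 2 * Real.pi = Real.pi by ring,
    intervalIntegral.integral_of_le (by linarith [Real.pi_pos]),
    intervalIntegral.integral_of_le (by linarith [Real.pi_pos]),
    integral_Ioc_eq_integral_Ioo (y := Real.pi)] at h'
  rw [intervalIntegral.integral_of_le (by linarith [Real.pi_pos]), h'] at h
  have hmap : ∀ θ : ℝ, Complex.polarCoord.symm (r, θ) = circleMap 0 r θ := fun θ => by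
    rw [Complex.polarCoord_symm_apply, circleMap_zero, Complex.exp_mul_I]
    push_cast; rfl
  simp only [hmap]
  rw [← h, Complex.real_smul]
  have hpi : (Real.pi : ℂ) ≠ 0 := by exact_mod_cast Real.pi_ne_zero
  push_cast
  field_simp

/-- The Gaussian mean value property of entire functions. -/
theorem integral_mul_exp_neg_norm_sq {g : ℂ → ℂ} (hg : Differentiable ℂ g)
    (hi : Integrable fun u : ℂ => g u * (Real.exp (-‖u‖ ^ 2) : ℂ)) :
    ∫ u : ℂ, g u * (Real.exp (-‖u‖ ^ 2) : ℂ) = Real.pi * g 0 := by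
  have hc : Continuous fun u : ℂ => g u * (Real.exp (-‖u‖ ^ 2) : ℂ) := by
    have := hg.continuous
    fun_prop
  have hpol := integrableOn_polarCoord_target_of_integrable hc hi
  rw [← Complex.integral_comp_polarCoord_symm]
  rw [polarCoord_target, Measure.volume_eq_prod] at hpol ⊢
  rw [setIntegral_prod _ hpol]
  have hin : ∀ r : ℝ, ∫ θ in Set.Ioo (-Real.pi) Real.pi,
      (r, θ).1 • (g (Complex.polarCoord.symm (r, θ)) *
        (Real.exp (-‖Complex.polarCoord.symm (r, θ)‖ ^ 2) : ℂ)) =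
      ((r : ℂ) * cexp (-1 * (r : ℂ) ^ 2)) * (2 * Real.pi * g 0) := fun r => by
    rw [← integral_polarCoord_symm_eq hg r, ← integral_const_mul]
    refine integral_congr_ae (ae_of_all _ fun θ => ?_)
    simp only [Complex.norm_polarCoord_symm, sq_abs, Complex.real_smul]
    push_cast
    rw [neg_one_mul]
    ring
  simp only [hin]
  rw [integral_mul_const, integral_mul_cexp_neg_mul_sq (by simp)]
  ring

/-- A polynomial times `e^{-x}` decays at least cubically. -/
theorem pow_mul_exp_neg_le {x : ℝ} (hx : 0 ≤ x) (n : ℕ) :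
    x ^ n * Real.exp (-x) ≤
      (Real.exp 1 * (n + 3).factorial) * (1 + x) ^ (-3 : ℝ) := by
  have h1 : 0 < 1 + x := by linarith
  have h := Real.pow_div_factorial_le_exp (x := 1 + x) h1.le (n + 3)
  rw [div_le_iff₀ (by positivity)] at h
  have hrp : (1 + x) ^ (-3 : ℝ) = ((1 + x) ^ 3)⁻¹ := by
    rw [Real.rpow_neg h1.le]; norm_cast
  have hxn : x ^ n ≤ (1 + x) ^ n := by gcongr; linarith
  rw [hrp, ← div_eq_mul_inv, le_div_iff₀ (by positivity)]
  calc x ^ n * Real.exp (-x) * (1 + x) ^ 3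
      ≤ (1 + x) ^ n * Real.exp (-x) * (1 + x) ^ 3 := by gcongr
    _ = (1 + x) ^ (n + 3) * Real.exp (-x) := by ring
    _ ≤ Real.exp (1 + x) * (n + 3).factorial * Real.exp (-x) := by gcongr
    _ = Real.exp 1 * (n + 3).factorial := by
      rw [Real.exp_add, mul_right_comm, mul_assoc (Real.exp 1), ← Real.exp_add]
      simp

/-- The Fock integrand whose integral represents the `α`-th derivative of `f` at `z`. -/
noncomputable def fockIntegrand (f : ℂ → ℂ) (α : ℕ) (z w : ℂ) : ℂ :=
  ((starRingEnd ℂ) w) ^ α * Complex.exp (z * (starRingEnd ℂ) w) * f w *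
    (Real.exp (-‖w‖ ^ 2) : ℂ)

theorem continuous_fockIntegrand {f : ℂ → ℂ} (hf : Continuous f) (α : ℕ) (z : ℂ) :
    Continuous (fockIntegrand f α z) := by
  have := Complex.continuous_conj
  unfold fockIntegrand
  fun_prop

/-- A cubically decaying bound for the Fock integrand, uniform for `z` in a ball. -/
theorem exists_norm_fockIntegrand_le {f : ℂ → ℂ} (hf : MemDOneMinus f) (α : ℕ) {R : ℝ}
    (hR : 0 ≤ R) :
    ∃ K : ℝ, ∀ z w : ℂ, ‖z‖ ≤ R → ‖fockIntegrand f α z w‖ ≤ K * (1 + ‖w‖) ^ (-3 : ℝ) := by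
  obtain ⟨C, hC⟩ := hf (R + 1) (by linarith)
  have hC0 : 0 ≤ C := by simpa using (norm_nonneg _).trans (hC 0)
  refine ⟨C * (Real.exp 1 * (α + 3).factorial), fun z w hz => ?_⟩
  have hexp : ‖cexp (z * (starRingEnd ℂ) w)‖ ≤ Real.exp (R * ‖w‖) := by
    refine (Complex.norm_exp_le_exp_norm _).trans (Real.exp_le_exp.2 ?_)
    rw [norm_mul, RCLike.norm_conj]
    gcongr
  calc ‖fockIntegrand f α z w‖
      = ‖w‖ ^ α * ‖cexp (z * (starRingEnd ℂ) w)‖ * ‖f w‖ * Real.exp (-‖w‖ ^ 2) := by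
        simp only [fockIntegrand, norm_mul, norm_pow, RCLike.norm_conj, Complex.norm_real,
          Real.norm_eq_abs, Real.abs_exp]
    _ ≤ ‖w‖ ^ α * Real.exp (R * ‖w‖) * (C * Real.exp (‖w‖ ^ 2 - (R + 1) * ‖w‖)) *
          Real.exp (-‖w‖ ^ 2) := by
        gcongr
        exact hC w
    _ = C * (‖w‖ ^ α *
          (Real.exp (R * ‖w‖) * Real.exp (‖w‖ ^ 2 - (R + 1) * ‖w‖) * Real.exp (-‖w‖ ^ 2))) := by
        ring
    _ = C * (‖w‖ ^ α * Real.exp (-‖w‖)) := by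
        rw [← Real.exp_add, ← Real.exp_add]
        ring_nf
    _ ≤ C * (Real.exp 1 * (α + 3).factorial) * (1 + ‖w‖) ^ (-3 : ℝ) := by
        rw [mul_assoc C]
        exact mul_le_mul_of_nonneg_left (pow_mul_exp_neg_le (norm_nonneg w) α) hC0

theorem integrable_one_add_norm_rpow_neg_three :
    Integrable fun w : ℂ => (1 + ‖w‖) ^ (-3 : ℝ) :=
  integrable_one_add_norm (by rw [Complex.finrank_real_complex]; norm_num)

theorem integrable_fockIntegrand {f : ℂ → ℂ} (hf : Continuous f) (hfD : MemDOneMinus f)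
    (α : ℕ) (z : ℂ) : Integrable (fockIntegrand f α z) := by
  obtain ⟨K, hK⟩ := exists_norm_fockIntegrand_le hfD α (norm_nonneg z)
  exact (integrable_one_add_norm_rpow_neg_three.const_mul K).mono'
    (continuous_fockIntegrand hf α z).aestronglyMeasurable
    (ae_of_all _ fun w => hK z w le_rfl)

/-- Differentiation of the Fock integral under the integral sign. -/
theorem hasDerivAt_integral_fockIntegrand {f : ℂ → ℂ} (hf : Continuous f)
    (hfD : MemDOneMinus f) (α : ℕ) (z : ℂ) :
    HasDerivAt (fun z => ∫ w, fockIntegrand f α z w) (∫ w, fockIntegrand f (α + 1) z w) z := by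
  obtain ⟨K, hK⟩ := exists_norm_fockIntegrand_le hfD (α + 1) (R := ‖z‖ + 1) (by positivity)
  refine (hasDerivAt_integral_of_dominated_loc_of_deriv_le
    (bound := fun w => K * (1 + ‖w‖) ^ (-3 : ℝ)) (Metric.ball_mem_nhds z one_pos)
    (Eventually.of_forall fun x => (continuous_fockIntegrand hf α x).aestronglyMeasurable)
    (integrable_fockIntegrand hf hfD α z)
    (continuous_fockIntegrand hf (α + 1) z).aestronglyMeasurable
    (ae_of_all _ fun w x hx => hK x w ?_)
    (integrable_one_add_norm_rpow_neg_three.const_mul K)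
    (ae_of_all _ fun w x _ => ?_)).2
  · have h := norm_sub_norm_le x z
    rw [Metric.mem_ball, dist_eq_norm] at hx
    linarith
  · have h := ((((hasDerivAt_id x).mul_const ((starRingEnd ℂ) w)).cexp.const_mul
      (((starRingEnd ℂ) w) ^ α)).mul_const (f w)).mul_const (Real.exp (-‖w‖ ^ 2) : ℂ)
    refine h.congr_deriv ?_
    simp only [fockIntegrand, id]
    ring

/-- The reproducing identity of the Fock kernel. -/
theorem integral_fockIntegrand_zero {f : ℂ → ℂ} (hf : Differentiable ℂ f)
    (hfD : MemDOneMinus f) (z : ℂ) : ∫ w, fockIntegrand f 0 z w = Real.pi * f z := by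
  have hshift : ∀ u : ℂ, fockIntegrand f 0 z (u + z) =
      cexp (-((starRingEnd ℂ) z * u)) * f (u + z) * (Real.exp (-‖u‖ ^ 2) : ℂ) := fun u => by
    have hsq : ∀ v : ℂ, ((Real.exp (-‖v‖ ^ 2) : ℝ) : ℂ) = cexp (-(v * (starRingEnd ℂ) v)) :=
      fun v => by rw [Complex.mul_conj']; push_cast; rfl
    simp only [fockIntegrand, hsq, pow_zero, one_mul]
    rw [mul_right_comm, mul_right_comm _ (f _), ← Complex.exp_add, ← Complex.exp_add]
    congr 2
    simp only [map_add]
    ring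
  have hint := (integrable_fockIntegrand hf.continuous hfD 0 z).comp_add_right z
  simp only [hshift] at hint
  rw [← integral_add_right_eq_self _ z]
  simp only [hshift]
  rw [integral_mul_exp_neg_norm_sq (g := fun u => cexp (-((starRingEnd ℂ) z * u)) * f (u + z))
    (by fun_prop) hint]
  simp

theorem iteratedDeriv_eq_integral_fockIntegrand {f : ℂ → ℂ} (hf : Differentiable ℂ f)
    (hfD : MemDOneMinus f) (α : ℕ) :
    iteratedDeriv α f = fun z => (1 / (Real.pi : ℂ)) * ∫ w, fockIntegrand f α z w := by
  induction α with
  | zero =>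
    ext z
    have hpi : (Real.pi : ℂ) ≠ 0 := by exact_mod_cast Real.pi_ne_zero
    rw [iteratedDeriv_zero, integral_fockIntegrand_zero hf hfD]
    field_simp
  | succ α ih =>
    ext z
    rw [iteratedDeriv_succ, ih]
    exact ((hasDerivAt_integral_fockIntegrand hf.continuous hfD α z).const_mul _).deriv

theorem fock_reproducing_property_derivatives
    (f : ℂ → ℂ) (hf : Differentiable ℂ f) (hfD : MemDOneMinus f) :
    ∀ (α : ℕ) (z : ℂ),
      Integrable (fun w : ℂ =>
        ((starRingEnd ℂ) w) ^ α * Complex.exp (z * (starRingEnd ℂ) w) * f w *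
          (Real.exp (-‖w‖ ^ 2) : ℂ)) ∧
      iteratedDeriv α f z = (1 / (Real.pi : ℂ)) * ∫ w : ℂ,
        ((starRingEnd ℂ) w) ^ α * Complex.exp (z * (starRingEnd ℂ) w) * f w *
          (Real.exp (-‖w‖ ^ 2) : ℂ) := by
  intro α z
  exact ⟨integrable_fockIntegrand hf.continuous hfD α z,
    congrFun (iteratedDeriv_eq_integral_fockIntegrand hf hfD α) z⟩
end

section
/- Let N ≥ 1 and let f_1, …, f_N : ℂ → ℂ be entire functions whose Wronskian vanishes identically, i.e., for every z ∈ ℂ the N×N matrix whose (i,j) entry is the (i−1)-st complex derivative f_j^{(i−1)}(z) has determinant 0. Then f_1, …, f_N are linearly dependent over ℂ: there exist complex numbers c_1, …, c_N, not all zero, with Σ_{j=1}^N c_j f_j(z) = 0 for all z ∈ ℂ. -/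
open Filter Topology Matrix

lemma AnalyticAt.analyticOrderAt_iteratedDeriv {g : ℂ → ℂ} {z₀ : ℂ} (hg : AnalyticAt ℂ g z₀)
    {k n : ℕ} (hn : analyticOrderAt g z₀ = n) (hk : k ≤ n) :
    analyticOrderAt (iteratedDeriv k g) z₀ = (n - k : ℕ) := by
  rcases Nat.eq_zero_or_pos n with rfl | hpos
  · obtain rfl : k = 0 := by omega
    simpa using hn
  · rw [iteratedDeriv_eq_iterate]
    exact analyticOrderAt_iterated_deriv hg hn.symm hpos.ne' hk

/-- A solution of a homogeneous linear differential equation with continuous coefficients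
whose initial data vanish is identically zero near the initial point. -/
lemma AnalyticAt.eventually_eq_zero_of_linear_ode {g : ℂ → ℂ} {z₀ : ℂ} (hg : AnalyticAt ℂ g z₀)
    {r : ℕ} {a : Fin r → ℂ → ℂ} (ha : ∀ i, ContinuousAt (a i) z₀)
    (hode : ∀ᶠ z in 𝓝 z₀, iteratedDeriv r g z = ∑ i, a i z * iteratedDeriv (i : ℕ) g z)
    (hinit : ∀ i < r, iteratedDeriv i g z₀ = 0) :
    ∀ᶠ z in 𝓝 z₀, g z = 0 := by
  rw [← analyticOrderAt_eq_top]
  by_contra hne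
  obtain ⟨n, hn⟩ := ENat.ne_top_iff_exists.mp hne
  have hrn : r ≤ n := by
    have := (natCast_le_analyticOrderAt_iff_iteratedDeriv_eq_zero hg).mpr hinit
    rw [← hn] at this
    exact_mod_cast this
  have han (k : ℕ) : AnalyticAt ℂ (iteratedDeriv k g) z₀ := by
    rw [iteratedDeriv_eq_iterate]
    exact hg.iterated_deriv k
  obtain ⟨h, hh, hh0, hr⟩ := (han r).analyticOrderAt_eq_natCast.mp
    (hg.analyticOrderAt_iteratedDeriv hn.symm hrn)
  have hlow (i : Fin r) : ∃ u : ℂ → ℂ, AnalyticAt ℂ u z₀ ∧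
      ∀ᶠ z in 𝓝 z₀, iteratedDeriv (i : ℕ) g z = (z - z₀) ^ (n - r + 1) • u z := by
    rw [← natCast_le_analyticOrderAt (han i),
      hg.analyticOrderAt_iteratedDeriv hn.symm (i.2.le.trans hrn)]
    have := i.2
    exact_mod_cast (by omega : n - r + 1 ≤ n - i)
  choose u hu hiu using hlow
  have heq : h =ᶠ[𝓝[≠] z₀] fun z => (z - z₀) * ∑ i, a i z * u i z := by
    filter_upwards [nhdsWithin_le_nhds hode, nhdsWithin_le_nhds hr,
      nhdsWithin_le_nhds (eventually_all.mpr hiu), self_mem_nhdsWithin] with z h1 h2 h3 h4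
    have hz : (z - z₀) ^ (n - r) ≠ 0 := pow_ne_zero _ (sub_ne_zero.mpr h4)
    apply mul_left_cancel₀ hz
    rw [← smul_eq_mul, ← h2, h1, ← mul_assoc, ← pow_succ, Finset.mul_sum]
    refine Finset.sum_congr rfl fun i _ => ?_
    rw [h3 i, smul_eq_mul]
    ring
  have hcont : ContinuousAt (fun z => (z - z₀) * ∑ i, a i z * u i z) z₀ :=
    (continuousAt_id.sub continuousAt_const).mul <|
      tendsto_finsetSum _ fun i _ => (ha i).mul (hu i).continuousAt
  have hlim := tendsto_nhds_unique
    (hh.continuousAt.tendsto.mono_left nhdsWithin_le_nhds)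
    ((hcont.tendsto.mono_left nhdsWithin_le_nhds).congr' heq.symm)
  exact hh0 (by simpa using hlim)

lemma Matrix.exists_right_inverse_of_linearIndependent_row {K m n : Type*} [Field K] [Fintype m]
    [DecidableEq m] [Fintype n] {A : Matrix m n K} (hA : LinearIndependent K A.row) :
    ∃ B : Matrix n m K, A * B = 1 := by
  rw [← mulVec_surjective_iff_exists_right_inverse]
  have : LinearMap.range A.mulVecLin = ⊤ :=
    Submodule.eq_top_of_finrank_eq (by simpa [Matrix.rank] using hA.rank_matrix)
  exact LinearMap.range_eq_top.mp this

/-- If vector functions `v₀, …, vᵣ` are continuous, the first `r` are linearly independent at a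
point and all of them are linearly dependent everywhere, then near that point `vᵣ` is a linear
combination of the others with continuous coefficients. -/
lemma exists_continuousAt_coeff_of_linearIndependent {X ι : Type*} [TopologicalSpace X]
    [Fintype ι] {v : ℕ → X → ι → ℂ} (hv : ∀ k, Continuous (v k)) {r : ℕ} {x₀ : X}
    (hind : LinearIndependent ℂ fun i : Fin r => v i x₀)
    (hdep : ∀ x, ¬ LinearIndependent ℂ fun i : Fin (r + 1) => v i x) :
    ∃ a : Fin r → X → ℂ, (∀ i, ContinuousAt (a i) x₀) ∧
      ∀ᶠ x in 𝓝 x₀, v r x = ∑ i, a i x • v i x := by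
  let A : X → Matrix (Fin r) ι ℂ := fun x => Matrix.of fun i => v i x
  have hAc : Continuous A := continuous_pi fun i => hv i
  obtain ⟨B, hB⟩ := Matrix.exists_right_inverse_of_linearIndependent_row (A := A x₀) hind
  have hABc : Continuous fun x => A x * B := hAc.matrix_mul continuous_const
  have hdet : ∀ᶠ x in 𝓝 x₀, (A x * B).det ≠ 0 :=
    hABc.matrix_det.continuousAt.eventually_ne (by simp [hB])
  have hinv : ContinuousAt (fun x => (A x * B)⁻¹) x₀ := by
    refine ContinuousAt.comp (g := Inv.inv) ?_ hABc.continuousAt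
    refine continuousAt_matrix_inv _ ?_
    rw [Ring.inverse_eq_inv']
    exact continuousAt_inv₀ (by simp [hB])
  refine ⟨fun i x => ((v r x ᵥ* B) ᵥ* (A x * B)⁻¹) i, fun i => ?_, ?_⟩
  · have hvB : Continuous fun x => v r x ᵥ* B := (hv r).matrix_vecMul continuous_const
    have hentry (j : Fin r) : ContinuousAt (fun x => (A x * B)⁻¹ j i) x₀ :=
      (continuous_apply_apply j i).continuousAt.comp hinv
    have hsum : ContinuousAt (fun x => ∑ j, (v r x ᵥ* B) j * (A x * B)⁻¹ j i) x₀ :=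
      tendsto_finsetSum _ fun j _ =>
        ((continuous_apply j).comp hvB).continuousAt.mul (hentry j)
    exact hsum
  · filter_upwards [hdet] with x hx
    have hunit : IsUnit (A x * B).det := hx.isUnit
    have hli : LinearIndependent ℂ fun i : Fin r => v i x := by
      refine Matrix.vecMul_injective_iff (M := A x) |>.mp fun p q hpq => ?_
      have := congrArg (· ᵥ* B) hpq
      simp only [vecMul_vecMul] at this
      exact Matrix.vecMul_injective_of_isUnit
        ((Matrix.isUnit_iff_isUnit_det _).mpr hunit) this
    have hspan : v r x ∈ Submodule.span ℂ (Set.range fun i : Fin r => v i x) := by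
      by_contra hnot
      apply hdep x
      have hsnoc : (fun i : Fin (r + 1) => v i x) =
          Fin.snoc (α := fun _ => ι → ℂ) (fun i : Fin r => v i x) (v r x) := by
        funext i
        refine Fin.lastCases ?_ (fun j => ?_) i <;> simp
      rw [hsnoc]
      exact linearIndependent_finSnoc.mpr ⟨hli, hnot⟩
    obtain ⟨b, hb⟩ := Submodule.mem_span_range_iff_exists_fun ℂ |>.mp hspan
    have hbA : b ᵥ* A x = v r x := by
      rw [← hb, vecMul_eq_sum]
      rfl
    have : (v r x ᵥ* B) ᵥ* (A x * B)⁻¹ = b := by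
      rw [← hbA, vecMul_vecMul, vecMul_vecMul, ← Matrix.mul_assoc,
        Matrix.mul_nonsing_inv _ hunit, vecMul_one]
    simp only [this, hb]

theorem wronskian_vanishes_implies_linear_dependence
    (N : ℕ) (hN : 1 ≤ N) (f : Fin N → ℂ → ℂ)
    (hf : ∀ j, Differentiable ℂ (f j))
    (hW : ∀ z : ℂ,
      (Matrix.of fun i j : Fin N => iteratedDeriv (i : ℕ) (f j) z).det = 0) :
    ∃ c : Fin N → ℂ, c ≠ 0 ∧ ∀ z : ℂ, ∑ j, c j * f j z = 0 := by
  let v : ℕ → ℂ → Fin N → ℂ := fun k z j => iteratedDeriv k (f j) z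
  have hv (k : ℕ) : Continuous (v k) := continuous_pi fun j =>
    ((hf j).contDiff (n := k)).continuous_iteratedDeriv k le_rfl
  have hvN : ¬ ∃ z, LinearIndependent ℂ fun i : Fin N => v i z := by
    rintro ⟨z, hz⟩
    have hunit := Matrix.linearIndependent_rows_iff_isUnit
      (A := Matrix.of fun i j : Fin N => iteratedDeriv (i : ℕ) (f j) z) |>.mp hz
    rw [Matrix.isUnit_iff_isUnit_det, hW z] at hunit
    exact not_isUnit_zero hunit
  obtain ⟨r, hrN, ⟨z₀, hind⟩, hdep⟩ : ∃ r < N,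
      (∃ z, LinearIndependent ℂ fun i : Fin r => v i z) ∧
      ¬ ∃ z, LinearIndependent ℂ fun i : Fin (r + 1) => v i z := by
    by_contra! hcon
    have hall : ∀ k ≤ N, ∃ z, LinearIndependent ℂ fun i : Fin k => v i z := by
      intro k
      induction k with
      | zero => exact fun _ => ⟨0, linearIndependent_empty_type⟩
      | succ k ih => exact fun hk => hcon k hk (ih (by omega))
    exact hvN (hall N le_rfl)
  push Not at hdep
  obtain ⟨a, ha, hva⟩ := exists_continuousAt_coeff_of_linearIndependent hv hind hdep
  obtain ⟨c, hc, hc0⟩ := Submodule.exists_mem_ne_zero_of_ne_bot <|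
    LinearMap.ker_ne_bot_of_finrank_lt
      (f := (Matrix.of fun i : Fin r => v i z₀).mulVecLin) (by simpa using hrN)
  have hderiv (k : ℕ) (z : ℂ) :
      iteratedDeriv k (fun z => ∑ j, c j * f j z) z = ∑ j, c j * v k z j := by
    rw [iteratedDeriv_fun_sum fun j _ => (contDiff_const.mul (hf j).contDiff).contDiffAt]
    simp [v, iteratedDeriv_const_mul_field]
  have hg : Differentiable ℂ fun z => ∑ j, c j * f j z := by fun_prop
  have hzero : ∀ᶠ z in 𝓝 z₀, ∑ j, c j * f j z = 0 := by
    refine (hg.analyticAt z₀).eventually_eq_zero_of_linear_ode ha ?_ fun i hi => ?_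
    · filter_upwards [hva] with z hz
      simp only [hderiv, hz, Finset.sum_apply, Pi.smul_apply, smul_eq_mul, Finset.mul_sum]
      rw [Finset.sum_comm]
      exact Finset.sum_congr rfl fun i _ => Finset.sum_congr rfl fun j _ => by ring
    · rw [hderiv]
      have := congrFun (LinearMap.mem_ker.mp hc) ⟨i, hi⟩
      simpa [mulVec, dotProduct, mul_comm] using this
  refine ⟨c, hc0, fun z => ?_⟩
  exact AnalyticOnNhd.eqOn_zero_of_preconnected_of_eventuallyEq_zero
    (fun z _ => hg.analyticAt z) isPreconnected_univ (Set.mem_univ z₀) hzero (Set.mem_univ z)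
end

section
/- Let F : ℂ → ℂ be a measurable function in the class 𝔇_{1,-}. Suppose there exist N ∈ ℕ and entire functions f_1,…,f_N, g_1,…,g_N : ℂ → ℂ in 𝔇_{1,-} such that for all k, k' ∈ ℕ: (1/π) ∫_ℂ F(w) w^k conj(w)^{k'} e^{−|w|²} dλ(w) = Σ_{j=1}^N [(1/π) ∫_ℂ w^k conj(g_j(w)) e^{−|w|²} dλ(w)] · [(1/π) ∫_ℂ f_j(w) conj(w)^{k'} e^{−|w|²} dλ(w)]. Then F = 0 almost everywhere on ℂ. -/
open MeasureTheory Complex Filter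

/-- A nondegenerate finite minor of maximal size of a finite-rank kernel factorizes the kernel. -/
theorem exists_factorization_of_finite_rank {X Y : Type*} (Φ : X → Y → ℂ) {N : ℕ}
    (u : Fin N → X → ℂ) (v : Fin N → Y → ℂ) (hΦ : ∀ x y, Φ x y = ∑ j, u j x * v j y) :
    ∃ (r : ℕ) (α : Fin r → X) (β : Fin r → Y),
      (Matrix.of fun i j => Φ (α i) (β j)).det ≠ 0 ∧
      ∀ x y, Φ x y = ∑ i, (∑ j, Φ x (β j) *
        (Matrix.of fun i j => Φ (α i) (β j))⁻¹ j i) * Φ (α i) y := by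
  classical
  let p : ℕ → Prop := fun r => ∃ (α : Fin r → X) (β : Fin r → Y),
    (Matrix.of fun i j => Φ (α i) (β j)).det ≠ 0
  have hp0 : p 0 := ⟨Fin.elim0, Fin.elim0, by simp⟩
  have hbound : ∀ r, p r → r ≤ N := by
    rintro r ⟨α, β, h⟩
    have hfac : (Matrix.of fun i j => Φ (α i) (β j)) =
        (Matrix.of fun (i : Fin r) (k : Fin N) => u k (α i)) *
          Matrix.of fun (k : Fin N) (j : Fin r) => v k (β j) := by
      ext i j
      simp [Matrix.mul_apply, hΦ]
    have h1 := Matrix.rank_of_isUnit _ ((Matrix.isUnit_iff_isUnit_det _).2 h.isUnit)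
    rw [hfac] at h1
    have h2 := (Matrix.rank_mul_le_left (Matrix.of fun (i : Fin r) (k : Fin N) => u k (α i))
      (Matrix.of fun (k : Fin N) (j : Fin r) => v k (β j))).trans (Matrix.rank_le_width _)
    rw [h1] at h2
    simpa using h2
  obtain ⟨r, hr, α, β, hdet⟩ : ∃ r, r = Nat.findGreatest p N ∧ p r :=
    ⟨_, rfl, Nat.findGreatest_spec (P := p) (Nat.zero_le N) hp0⟩
  refine ⟨r, α, β, hdet, fun x y => ?_⟩
  set M : Matrix (Fin r) (Fin r) ℂ := Matrix.of fun i j => Φ (α i) (β j)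
  have hmax : ¬ p (r + 1) := fun h =>
    absurd (Nat.le_findGreatest (hbound _ h) h) (by omega)
  let e : Fin r ⊕ Unit ≃ Fin (r + 1) :=
    (Equiv.sumCongr (Equiv.refl _) finOneEquiv.symm).trans finSumFinEquiv
  let α' : Fin r ⊕ Unit → X := Sum.elim α fun _ => x
  let β' : Fin r ⊕ Unit → Y := Sum.elim β fun _ => y
  have hzero : (Matrix.of fun i j => Φ (α' i) (β' j)).det = 0 := by
    by_contra h
    refine hmax ⟨α' ∘ e.symm, β' ∘ e.symm, ?_⟩
    have : (Matrix.of fun i j => Φ ((α' ∘ e.symm) i) ((β' ∘ e.symm) j)) =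
        (Matrix.of fun i j => Φ (α' i) (β' j)).submatrix e.symm e.symm := rfl
    rwa [this, Matrix.det_submatrix_equiv_self]
  have hblock : (Matrix.of fun i j => Φ (α' i) (β' j)) = Matrix.fromBlocks M
      (Matrix.of fun i (_ : Unit) => Φ (α i) y) (Matrix.of fun (_ : Unit) j => Φ x (β j))
      (Matrix.of fun _ _ => Φ x y) := by
    ext (i | i) (j | j) <;> rfl
  let : Invertible M := Matrix.invertibleOfIsUnitDet M hdet.isUnit
  rw [hblock, Matrix.det_fromBlocks₁₁, mul_eq_zero, or_iff_right hdet, Matrix.det_unique,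
    Matrix.sub_apply, sub_eq_zero, Matrix.invOf_eq_nonsing_inv] at hzero
  simpa [Matrix.mul_apply] using hzero

/-- A finite-rank kernel, entire in both variables, all of whose translates vanish at infinity
along the antidiagonal `η = -conj ζ`, is zero. -/
theorem eq_zero_of_finite_rank_of_tendsto_zero (Φ : ℂ → ℂ → ℂ)
    (h₁ : ∀ η, Differentiable ℂ fun ζ => Φ ζ η) (h₂ : ∀ ζ, Differentiable ℂ (Φ ζ)) {N : ℕ}
    (u v : Fin N → ℂ → ℂ) (hΦ : ∀ ζ η, Φ ζ η = ∑ j, u j ζ * v j η)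
    (hlim : ∀ α β, Tendsto (fun ζ => Φ (ζ + α) (-(starRingEnd ℂ) ζ + β)) (cocompact ℂ)
      (nhds 0)) (ζ η : ℂ) : Φ ζ η = 0 := by
  obtain ⟨r, α, β, hdet, hfac⟩ := exists_factorization_of_finite_rank Φ u v hΦ
  rcases Nat.eq_zero_or_pos r with rfl | hr
  · simp [hfac ζ η]
  exfalso
  let A : ℂ → ℂ → Matrix (Fin r) (Fin r) ℂ := fun ζ η => Matrix.of fun i j => Φ (ζ + α i) (η + β j)
  have hA0 : A 0 0 = Matrix.of fun i j => Φ (α i) (β j) := by ext i j; simp [A]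
  have hdet0 : (A 0 0).det ≠ 0 := by rwa [hA0]
  have hAfac : ∀ ζ η, A ζ η = A ζ 0 * (A 0 0)⁻¹ * A 0 η := by
    intro ζ η
    ext i j
    rw [hA0]
    simpa [A, Matrix.mul_apply] using hfac (ζ + α i) (η + β j)
  have hD : ∀ ζ η, (A ζ η).det * (A 0 0).det = (A ζ 0).det * (A 0 η).det := by
    intro ζ η
    rw [hAfac ζ η, Matrix.det_mul, Matrix.det_mul, Matrix.det_nonsing_inv, Ring.inverse_eq_inv']
    field_simp
  let E : ℂ → ℂ := fun ζ => (A ζ 0).det *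
    (starRingEnd ℂ) ((fun η => (A 0 (-η)).det) ((starRingEnd ℂ) ζ))
  have hE1 : Differentiable ℂ fun ζ => (A ζ 0).det := by
    simp only [Matrix.det_apply, A, Matrix.of_apply]
    refine Differentiable.fun_sum fun σ _ => Differentiable.const_smul ?_ _
    exact Differentiable.fun_finsetProd fun i _ => (h₁ _).comp (differentiable_id.add_const _)
  have hE2 : Differentiable ℂ fun η => (A 0 (-η)).det := by
    simp only [Matrix.det_apply, A, Matrix.of_apply]
    refine Differentiable.fun_sum fun σ _ => Differentiable.const_smul ?_ _
    exact Differentiable.fun_finsetProd fun i _ =>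
      (h₂ _).comp (differentiable_id.neg.add_const _)
  have hE : Differentiable ℂ E :=
    hE1.mul fun z => differentiableAt_conj_conj_iff.2 (hE2 _)
  have hElim : Tendsto E (cocompact ℂ) (nhds 0) := by
    rw [tendsto_zero_iff_norm_tendsto_zero]
    have hnorm : ∀ ζ, ‖E ζ‖ = ‖(A ζ (-(starRingEnd ℂ) ζ)).det * (A 0 0).det‖ := by
      intro ζ
      rw [hD, norm_mul, norm_mul, RCLike.norm_conj]
    simp only [hnorm]
    rw [← tendsto_zero_iff_norm_tendsto_zero]
    have hA : Tendsto (fun ζ => A ζ (-(starRingEnd ℂ) ζ)) (cocompact ℂ) (nhds 0) :=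
      tendsto_pi_nhds.2 fun i => tendsto_pi_nhds.2 fun j => hlim (α i) (β j)
    have hcont : Continuous fun M : Matrix (Fin r) (Fin r) ℂ => M.det := continuous_id.matrix_det
    have : Nonempty (Fin r) := ⟨⟨0, hr⟩⟩
    simpa [Function.comp_def, Matrix.det_zero] using
      ((hcont.tendsto 0).comp hA).mul_const (A 0 0).det
  have hE0 : E 0 = 0 := hE.apply_eq_of_tendsto_cocompact 0 hElim
  simp [E, hdet0] at hE0

/-- Functions decaying at infinity faster than every exponential. -/
structure SuperExpDecay (ψ : ℂ → ℂ) : Prop where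
  aestronglyMeasurable : AEStronglyMeasurable ψ volume
  exists_bound : ∀ a : ℝ, ∃ C : ℝ, ∀ w, ‖ψ w‖ ≤ C * Real.exp (-a * ‖w‖)

theorem integrable_exp_neg_norm : Integrable fun w : ℂ => Real.exp (-‖w‖) := by
  have hint : Integrable fun w : ℂ => 27 * (1 + ‖w‖) ^ (-(3 : ℝ)) :=
    (integrable_one_add_norm (by rw [Complex.finrank_real_complex]; norm_num)).const_mul 27
  refine hint.mono' (by fun_prop) (Eventually.of_forall fun w => ?_)
  have hpos : 0 < 1 + ‖w‖ := by positivity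
  rw [Real.norm_of_nonneg (Real.exp_pos _).le, Real.rpow_neg hpos.le, Real.exp_neg,
    ← div_eq_mul_inv, inv_eq_one_div, div_le_div_iff₀ (Real.exp_pos _) (by positivity), one_mul]
  have h : (1 + ‖w‖) / 3 ≤ Real.exp (‖w‖ / 3) := by
    linarith [Real.add_one_le_exp (‖w‖ / 3)]
  have h3 := pow_le_pow_left₀ (by positivity) h 3
  rw [← Real.exp_nat_mul] at h3
  have e1 : ((3 : ℕ) : ℝ) * (‖w‖ / 3) = ‖w‖ := by push_cast; ring
  rw [e1] at h3
  have e2 : (1 + ‖w‖) ^ (3 : ℝ) = (1 + ‖w‖) ^ (3 : ℕ) := by exact_mod_cast Real.rpow_natCast _ 3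
  rw [e2]
  linarith

namespace SuperExpDecay

variable {ψ : ℂ → ℂ}

theorem integrable (hψ : SuperExpDecay ψ) : Integrable ψ := by
  obtain ⟨C, hC⟩ := hψ.exists_bound 1
  refine (integrable_exp_neg_norm.const_mul C).mono' hψ.aestronglyMeasurable
    (Eventually.of_forall fun w => ?_)
  simpa using hC w

theorem mul_left (hψ : SuperExpDecay ψ) {m : ℂ → ℂ} (hm : Continuous m) {b : ℝ}
    (hb : ∀ w, ‖m w‖ ≤ Real.exp (b * ‖w‖)) : SuperExpDecay fun w => m w * ψ w := by
  refine ⟨hm.aestronglyMeasurable.mul hψ.aestronglyMeasurable, fun a => ?_⟩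
  obtain ⟨C, hC⟩ := hψ.exists_bound (a + b)
  refine ⟨C, fun w => ?_⟩
  calc ‖m w * ψ w‖ = ‖m w‖ * ‖ψ w‖ := norm_mul _ _
    _ ≤ Real.exp (b * ‖w‖) * (C * Real.exp (-(a + b) * ‖w‖)) := by
      gcongr
      exacts [hb w, hC w]
    _ = C * (Real.exp (b * ‖w‖) * Real.exp (-(a + b) * ‖w‖)) := by ring
    _ = C * Real.exp (-a * ‖w‖) := by rw [← Real.exp_add]; ring_nf

theorem const_mul (hψ : SuperExpDecay ψ) (c : ℂ) : SuperExpDecay fun w => c * ψ w := by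
  refine ⟨hψ.aestronglyMeasurable.const_mul c, fun a => ?_⟩
  obtain ⟨C, hC⟩ := hψ.exists_bound a
  refine ⟨‖c‖ * C, fun w => ?_⟩
  rw [norm_mul, mul_assoc]
  gcongr
  exact hC w

variable {X : ℂ → ℂ}

theorem exp_mul_left (hψ : SuperExpDecay ψ) (hX : Continuous X) (hXn : ∀ w, ‖X w‖ ≤ ‖w‖) (ζ : ℂ) :
    SuperExpDecay fun w => cexp (ζ * X w) * ψ w := by
  refine hψ.mul_left (by fun_prop) (b := ‖ζ‖) fun w => ?_
  refine (Complex.norm_exp_le_exp_norm _).trans (Real.exp_le_exp.2 ?_)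
  rw [norm_mul]
  gcongr
  exact hXn w

theorem pow_mul_left (hψ : SuperExpDecay ψ) (hX : Continuous X) (hXn : ∀ w, ‖X w‖ ≤ ‖w‖) (k : ℕ) :
    SuperExpDecay fun w => X w ^ k * ψ w := by
  refine hψ.mul_left (by fun_prop) (b := k) fun w => ?_
  rw [norm_pow, Real.exp_nat_mul]
  gcongr
  linarith [hXn w, Real.add_one_le_exp ‖w‖]

theorem hasSum_integral_exp (hψ : SuperExpDecay ψ) (hX : Continuous X)
    (hXn : ∀ w, ‖X w‖ ≤ ‖w‖) (ζ : ℂ) :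
    HasSum (fun k : ℕ => ζ ^ k / (k.factorial : ℂ) * ∫ w, X w ^ k * ψ w)
      (∫ w, cexp (ζ * X w) * ψ w) := by
  simp_rw [← integral_const_mul]
  have hsum : ∀ w, HasSum (fun k : ℕ => (‖ζ‖ * ‖w‖) ^ k / (k.factorial : ℝ) * ‖ψ w‖)
      (Real.exp (‖ζ‖ * ‖w‖) * ‖ψ w‖) := fun w => by
    rw [Real.exp_eq_exp_ℝ]
    refine ((NormedSpace.exp_series_hasSum_exp' (𝕂 := ℝ) (‖ζ‖ * ‖w‖)).mul_right _).congr_fun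
      fun k => ?_
    rw [smul_eq_mul, div_eq_inv_mul]
  refine hasSum_integral_of_dominated_convergence
    (fun k w => (‖ζ‖ * ‖w‖) ^ k / (k.factorial : ℝ) * ‖ψ w‖) (fun k => ?_) (fun k => ?_) ?_ ?_ ?_
  · exact ((hψ.pow_mul_left hX hXn k).aestronglyMeasurable).const_mul _
  · refine Eventually.of_forall fun w => ?_
    rw [norm_mul, norm_mul, norm_div, norm_pow, norm_pow, Complex.norm_natCast, mul_pow,
      ← mul_assoc, div_mul_eq_mul_div]
    gcongr
    exact hXn w
  · exact Eventually.of_forall fun w => (hsum w).summable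
  · simp_rw [fun w => (hsum w).tsum_eq]
    have := (hψ.mul_left (m := fun w => cexp ((‖ζ‖ * ‖w‖ : ℝ))) (by fun_prop) (b := ‖ζ‖)
      fun w => by rw [Complex.norm_exp_ofReal]).integrable.norm
    simpa [Complex.norm_exp] using this
  · refine Eventually.of_forall fun w => ?_
    have := (NormedSpace.exp_series_hasSum_exp' (𝕂 := ℂ) (ζ * X w)).mul_right (ψ w)
    rw [← Complex.exp_eq_exp_ℂ] at this
    refine this.congr_fun fun k => ?_
    rw [smul_eq_mul, mul_pow]
    ring

theorem differentiable_integral_exp (hψ : SuperExpDecay ψ) (hX : Continuous X)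
    (hXn : ∀ w, ‖X w‖ ≤ ‖w‖) : Differentiable ℂ fun ζ => ∫ w, cexp (ζ * X w) * ψ w := by
  intro ζ₀
  have hdecay := hψ.pow_mul_left hX hXn 1
  have hbound : Integrable fun w => ‖cexp (((‖ζ₀‖ + 1) * ‖w‖ : ℝ)) * (X w ^ 1 * ψ w)‖ :=
    (hdecay.mul_left (m := fun w => cexp (((‖ζ₀‖ + 1) * ‖w‖ : ℝ))) (by fun_prop) (b := ‖ζ₀‖ + 1)
      fun w => by rw [Complex.norm_exp_ofReal]).integrable.norm
  refine (hasDerivAt_integral_of_dominated_loc_of_deriv_le (Metric.ball_mem_nhds ζ₀ one_pos)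
    (F' := fun ζ w => cexp (ζ * X w) * (X w ^ 1 * ψ w))
    (Eventually.of_forall fun ζ => (hψ.exp_mul_left hX hXn ζ).aestronglyMeasurable)
    (hψ.exp_mul_left hX hXn ζ₀).integrable
    (hdecay.exp_mul_left hX hXn ζ₀).aestronglyMeasurable
    (Eventually.of_forall fun w ζ hζ => ?_) hbound
    (Eventually.of_forall fun w ζ _ => ?_)).2.differentiableAt
  · rw [norm_mul, norm_mul _ (X w ^ 1 * ψ w), Complex.norm_exp_ofReal]
    gcongr
    refine (Complex.norm_exp_le_exp_norm _).trans (Real.exp_le_exp.2 ?_)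
    rw [norm_mul]
    gcongr
    · have h1 : ‖ζ - ζ₀‖ < 1 := by simpa [dist_eq_norm] using hζ
      linarith [norm_le_norm_add_norm_sub' ζ ζ₀]
    · exact hXn w
  · have := (((hasDerivAt_id ζ).mul_const (X w)).cexp).mul_const (ψ w)
    simpa [mul_assoc] using this

end SuperExpDecay

/-- The two-variable exponential transform of `ψ`. -/
noncomputable def expTransform (ψ : ℂ → ℂ) (ζ η : ℂ) : ℂ :=
  ∫ w, cexp (ζ * w) * (cexp (η * (starRingEnd ℂ) w) * ψ w)

open FourierTransform in
theorem expTransform_neg_conj (ψ : ℂ → ℂ) (ζ : ℂ) :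
    expTransform ψ ζ (-(starRingEnd ℂ) ζ) = 𝓕 ψ (-(I / Real.pi) * (starRingEnd ℂ) ζ) := by
  rw [Real.fourier_eq', expTransform]
  refine integral_congr_ae (Eventually.of_forall fun w => ?_)
  simp only
  rw [← mul_assoc, ← Complex.exp_add, smul_eq_mul]
  congr 2
  have hpi : (Real.pi : ℝ) ≠ 0 := Real.pi_ne_zero
  apply Complex.ext
  · simp [Complex.inner]
  · simp [Complex.inner]
    field_simp
    ring

theorem tendsto_expTransform_neg_conj (ψ : ℂ → ℂ) :
    Tendsto (fun ζ => expTransform ψ ζ (-(starRingEnd ℂ) ζ)) (cocompact ℂ) (nhds 0) := by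
  simp_rw [expTransform_neg_conj]
  refine (tendsto_integral_exp_inner_smul_cocompact ψ).comp ?_
  rw [← Metric.cobounded_eq_cocompact, ← tendsto_norm_atTop_iff_cobounded]
  have : Tendsto (fun ζ : ℂ => ‖I / (Real.pi : ℂ)‖ * ‖ζ‖) (Bornology.cobounded ℂ) atTop :=
    tendsto_norm_cobounded_atTop.const_mul_atTop (by simp [Real.pi_ne_zero])
  refine this.congr fun ζ => ?_
  rw [norm_mul, norm_neg, RCLike.norm_conj]

open FourierTransform SchwartzMap in
/-- An integrable function with vanishing Fourier transform vanishes almost everywhere. -/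
theorem ae_eq_zero_of_fourier_eq_zero_s12 {ψ : ℂ → ℂ} (hψ : Integrable ψ) (h : ∀ v, 𝓕 ψ v = 0) :
    ψ =ᵐ[volume] 0 := by
  refine ae_eq_zero_of_integral_contDiff_smul_eq_zero hψ.locallyIntegrable fun g hg hgs => ?_
  have hgc : ContDiff ℝ ((⊤ : ℕ∞) : WithTop ℕ∞) fun x => (g x : ℂ) :=
    Complex.ofRealCLM.contDiff.comp hg
  have hgcs : HasCompactSupport fun x => (g x : ℂ) := hgs.comp_left Complex.ofReal_zero
  let G : 𝓢(ℂ, ℂ) := hgcs.toSchwartzMap hgc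
  let K : 𝓢(ℂ, ℂ) := 𝓕⁻ G
  have hK : ∀ x, 𝓕 (K : ℂ → ℂ) x = g x := fun x => by
    rw [← SchwartzMap.fourier_coe, FourierTransform.fourier_fourierInv_eq]
    rfl
  have key := VectorFourier.integral_fourierIntegral_smul_eq_flip (μ := volume) (ν := volume)
    (L := innerₗ ℂ) Real.continuous_fourierChar continuous_inner hψ K.integrable
  rw [flip_innerₗ] at key
  have e1 : ∀ v, VectorFourier.fourierIntegral Real.fourierChar volume (innerₗ ℂ) ψ v = 0 := h
  have e2 : ∀ x, VectorFourier.fourierIntegral Real.fourierChar volume (innerₗ ℂ) K x = g x := hK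
  simp_rw [e1, e2, zero_smul, integral_zero] at key
  rw [key]
  refine integral_congr_ae (Eventually.of_forall fun x => ?_)
  simp [mul_comm]

namespace SuperExpDecay

variable {ψ : ℂ → ℂ}

theorem exp_mul_left_id (hψ : SuperExpDecay ψ) (ζ : ℂ) :
    SuperExpDecay fun w => cexp (ζ * w) * ψ w :=
  hψ.exp_mul_left continuous_id (fun _ => le_rfl) ζ

theorem exp_conj_mul_left (hψ : SuperExpDecay ψ) (η : ℂ) :
    SuperExpDecay fun w => cexp (η * (starRingEnd ℂ) w) * ψ w :=
  hψ.exp_mul_left continuous_conj (fun w => (RCLike.norm_conj w).le) η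

theorem ae_eq_zero_of_expTransform_eq_zero (hψ : SuperExpDecay ψ)
    (h : ∀ ζ η, expTransform ψ ζ η = 0) : ψ =ᵐ[volume] 0 := by
  refine ae_eq_zero_of_fourier_eq_zero_s12 hψ.integrable fun v => ?_
  have hpi : (Real.pi : ℂ) ≠ 0 := Complex.ofReal_ne_zero.2 Real.pi_ne_zero
  have hv : -(I / Real.pi) * (starRingEnd ℂ) (-(Real.pi * I) * (starRingEnd ℂ) v) = v := by
    simp only [map_mul, map_neg, conj_conj, conj_I, conj_ofReal]
    field_simp
    simp
  rw [← hv, ← expTransform_neg_conj, h]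

theorem differentiable_expTransform_left (hψ : SuperExpDecay ψ) (η : ℂ) :
    Differentiable ℂ fun ζ => expTransform ψ ζ η :=
  (hψ.exp_conj_mul_left η).differentiable_integral_exp continuous_id fun _ => le_rfl

theorem differentiable_expTransform_right (hψ : SuperExpDecay ψ) (ζ : ℂ) :
    Differentiable ℂ (expTransform ψ ζ) := by
  have := (hψ.exp_mul_left_id ζ).differentiable_integral_exp continuous_conj
    fun w => (RCLike.norm_conj w).le
  change Differentiable ℂ fun η => expTransform ψ ζ η
  simpa only [expTransform, mul_left_comm] using this

theorem tendsto_expTransform_translate (ψ : ℂ → ℂ) (α β : ℂ) :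
    Tendsto (fun ζ => expTransform ψ (ζ + α) (-(starRingEnd ℂ) ζ + β)) (cocompact ℂ)
      (nhds 0) := by
  refine (tendsto_expTransform_neg_conj
    fun w => cexp (α * w) * (cexp (β * (starRingEnd ℂ) w) * ψ w)).congr fun ζ => ?_
  refine integral_congr_ae (Eventually.of_forall fun w => ?_)
  simp only [add_mul, Complex.exp_add]
  ring

/-- If the moment matrix of `ψ` has finite rank, so has its exponential transform. -/
theorem expTransform_eq_sum (hψ : SuperExpDecay ψ) {N : ℕ} {p q : Fin N → ℂ → ℂ}
    (hp : ∀ j, SuperExpDecay (p j)) (hq : ∀ j, SuperExpDecay (q j))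
    (h : ∀ k k' : ℕ, ∫ w, w ^ k * ((starRingEnd ℂ) w ^ k' * ψ w) =
      ∑ j, (∫ w, w ^ k * p j w) * ∫ w, (starRingEnd ℂ) w ^ k' * q j w) (ζ η : ℂ) :
    expTransform ψ ζ η = ∑ j, (∫ w, cexp (ζ * w) * p j w) *
      ∫ w, cexp (η * (starRingEnd ℂ) w) * q j w := by
  have hconj : ∀ w : ℂ, ‖(starRingEnd ℂ) w‖ ≤ ‖w‖ := fun w => (RCLike.norm_conj w).le
  have hleft : ∀ k' : ℕ, ∫ w, cexp (ζ * w) * ((starRingEnd ℂ) w ^ k' * ψ w) =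
      ∑ j, (∫ w, cexp (ζ * w) * p j w) * ∫ w, (starRingEnd ℂ) w ^ k' * q j w := by
    intro k'
    have h1 := (hψ.pow_mul_left continuous_conj hconj k').hasSum_integral_exp continuous_id
      (fun _ => le_rfl) ζ
    have h2 : HasSum _ _ := hasSum_sum (s := Finset.univ) fun j _ =>
      ((hp j).hasSum_integral_exp continuous_id (fun _ => le_rfl) ζ).mul_right
        (∫ w, (starRingEnd ℂ) w ^ k' * q j w)
    refine h1.unique (h2.congr_fun fun k => ?_)
    simp only [id_eq, h k k', Finset.mul_sum, mul_assoc]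
  have h1 := (hψ.exp_mul_left_id ζ).hasSum_integral_exp continuous_conj hconj η
  have h2 : HasSum _ _ := hasSum_sum (s := Finset.univ) fun j _ =>
    ((hq j).hasSum_integral_exp continuous_conj hconj η).mul_left (∫ w, cexp (ζ * w) * p j w)
  have h3 := h1.unique (h2.congr_fun fun k => by
    simp only [mul_left_comm _ (cexp _) _, hleft k, Finset.mul_sum]
    exact Finset.sum_congr rfl fun j _ => mul_left_comm _ _ _)
  rw [← h3, expTransform]
  simp only [mul_left_comm]

end SuperExpDecay

theorem MemDOneMinus.superExpDecay {h : ℂ → ℂ} (hh : MemDOneMinus h)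
    (hm : AEStronglyMeasurable h volume) :
    SuperExpDecay fun w => h w * (Real.exp (-‖w‖ ^ 2) : ℂ) := by
  refine ⟨hm.mul (by fun_prop), fun a => ?_⟩
  obtain ⟨C, hC⟩ := hh (max a 1) (by positivity)
  have hC0 : 0 ≤ C := by simpa using (norm_nonneg _).trans (hC 0)
  refine ⟨C, fun w => ?_⟩
  rw [norm_mul, Complex.norm_real, Real.norm_of_nonneg (Real.exp_pos _).le]
  calc ‖h w‖ * Real.exp (-‖w‖ ^ 2)
      ≤ C * Real.exp (‖w‖ ^ 2 - max a 1 * ‖w‖) * Real.exp (-‖w‖ ^ 2) := by gcongr; exact hC w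
    _ = C * Real.exp (-max a 1 * ‖w‖) := by rw [mul_assoc, ← Real.exp_add]; ring_nf
    _ ≤ C * Real.exp (-a * ‖w‖) := by gcongr; exact le_max_left _ _

theorem finite_rank_theorem_on_polynomials
    (F : ℂ → ℂ) (hFmeas : Measurable F) (hF : MemDOneMinus F)
    (N : ℕ) (f g : Fin N → ℂ → ℂ)
    (hf : ∀ j, Differentiable ℂ (f j)) (hg : ∀ j, Differentiable ℂ (g j))
    (hfD : ∀ j, MemDOneMinus (f j)) (hgD : ∀ j, MemDOneMinus (g j))
    (hform : ∀ k k' : ℕ,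
      (1 / (Real.pi : ℂ)) * ∫ w : ℂ, F w * w ^ k * ((starRingEnd ℂ) w) ^ k' *
          (Real.exp (-‖w‖ ^ 2) : ℂ)
        = ∑ j,
          ((1 / (Real.pi : ℂ)) * ∫ w : ℂ, w ^ k * (starRingEnd ℂ) (g j w) *
              (Real.exp (-‖w‖ ^ 2) : ℂ)) *
          ((1 / (Real.pi : ℂ)) * ∫ w : ℂ, f j w * ((starRingEnd ℂ) w) ^ k' *
              (Real.exp (-‖w‖ ^ 2) : ℂ))) :
    F =ᵐ[volume] 0 := by
  have hψ := hF.superExpDecay hFmeas.aestronglyMeasurable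
  have hp : ∀ j, SuperExpDecay fun w =>
      (starRingEnd ℂ) (g j w) * (Real.exp (-‖w‖ ^ 2) : ℂ) := fun j =>
    MemDOneMinus.superExpDecay (h := fun w => (starRingEnd ℂ) (g j w))
      (fun a ha => by simpa only [RCLike.norm_conj] using hgD j a ha)
      (continuous_conj.comp (hg j).continuous).aestronglyMeasurable
  have hq : ∀ j, SuperExpDecay fun w =>
      (1 / (Real.pi : ℂ)) * (f j w * (Real.exp (-‖w‖ ^ 2) : ℂ)) := fun j =>
    ((hfD j).superExpDecay (hf j).continuous.aestronglyMeasurable).const_mul _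
  have hmoments := hψ.expTransform_eq_sum hp hq fun k k' => by
    have hπ : 1 / (Real.pi : ℂ) ≠ 0 := one_div_ne_zero (Complex.ofReal_ne_zero.2 Real.pi_ne_zero)
    refine mul_left_cancel₀ hπ ?_
    rw [Finset.mul_sum]
    convert hform k k' using 2 with j
    · congr 1
      ext w
      ring
    · rw [← mul_assoc]
      congr 1
      · simp only [mul_assoc]
      · rw [← integral_const_mul]
        congr 1
        ext w
        ring
  have hzero := hψ.ae_eq_zero_of_expTransform_eq_zero <|
    eq_zero_of_finite_rank_of_tendsto_zero _ hψ.differentiable_expTransform_left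
      hψ.differentiable_expTransform_right _ _ hmoments
      (SuperExpDecay.tendsto_expTransform_translate _)
  filter_upwards [hzero] with w hw
  simpa [← Complex.ofReal_exp] using hw
end
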